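/- arXiv:2209.14601 — 10 statements merged into one kernel-verified Lean document; each statement's English description precedes it below -/
import Mathlib

section
/- If μ < λ < θ_1^{(k)}, then α_{k+1}^{(μ)} < α_{k+1}^{(λ)}, where α_{k+1}^{(ν)} = ν + β_k² e_k^T (T_k − ν I)^{−1} e_k for ν ∈ {μ, λ}. -/
open Matrix Finset

theorem inv_orthogonal_diagonal_sub_smul {n R : Type*} [Fintype n] [DecidableEq n] [Field R]
    {S : Matrix n n R} (hS : S * Sᵀ = 1) (θ : n → R) {ν : R} (hν : ∀ i, θ i ≠ ν) :
    (S * diagonal θ * Sᵀ - ν • 1)⁻¹ = S * diagonal (fun i => (θ i - ν)⁻¹) * Sᵀ := by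
  have hS' : Sᵀ * S = 1 := mul_eq_one_comm.mp hS
  have hsub : S * diagonal θ * Sᵀ - ν • 1 = S * diagonal (fun i => θ i - ν) * Sᵀ := by
    rw [← diagonal_sub, ← smul_one_eq_diagonal, mul_sub, sub_mul, Matrix.mul_smul,
      Matrix.smul_mul, mul_one, hS]
  have hdiag : diagonal (fun i => θ i - ν) * diagonal (fun i => (θ i - ν)⁻¹) = 1 := by
    rw [diagonal_mul_diagonal, ← diagonal_one]
    exact congrArg diagonal (funext fun i => mul_inv_cancel₀ (sub_ne_zero.mpr (hν i)))
  refine inv_eq_right_inv ?_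
  calc _ = S * diagonal (fun i => θ i - ν) * (Sᵀ * S) * diagonal (fun i => (θ i - ν)⁻¹) * Sᵀ := by
        rw [hsub]; simp only [Matrix.mul_assoc]
    _ = 1 := by rw [hS', mul_one, Matrix.mul_assoc S, hdiag, mul_one, hS]

theorem single_dotProduct_inv_mulVec_single {n R : Type*} [Fintype n] [DecidableEq n] [Field R]
    {S : Matrix n n R} (hS : S * Sᵀ = 1) (θ : n → R) {ν : R} (hν : ∀ i, θ i ≠ ν) (l : n) :
    Pi.single l 1 ⬝ᵥ (S * diagonal θ * Sᵀ - ν • 1)⁻¹ *ᵥ Pi.single l 1 =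
      ∑ j, S l j ^ 2 * (θ j - ν)⁻¹ := by
  rw [inv_orthogonal_diagonal_sub_smul hS θ hν, single_one_dotProduct, mulVec_single_one,
    col_apply, Matrix.mul_apply]
  refine sum_congr rfl fun j _ => ?_
  rw [mul_diagonal, transpose_apply]
  ring

/-- if `μ < λ < θ 0` then `α_{k+1}^{(μ)} < α_{k+1}^{(λ)}`,
where `α_{k+1}^{(ν)} = ν + β² eᵀ (T - νI)⁻¹ e`. -/
theorem stmt1
    (k : ℕ) (T S : Matrix (Fin (k + 1)) (Fin (k + 1)) ℝ)
    (θ : Fin (k + 1) → ℝ) (β μ lam : ℝ)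
    (hsymm : T.IsSymm)
    (htri : ∀ i j : Fin (k + 1), (i : ℕ) + 1 < (j : ℕ) → T i j = 0)
    (hoff : ∀ i : Fin k, 0 < T i.castSucc i.succ)
    (hθ : StrictMono θ)
    (hS : S * Sᵀ = 1)
    (hspec : T = S * Matrix.diagonal θ * Sᵀ)
    (hβ : 0 < β) (hμlam : μ < lam) (hlam : lam < θ 0) :
    μ + β ^ 2 * (Pi.single (Fin.last k) 1 ⬝ᵥ (T - μ • 1)⁻¹ *ᵥ Pi.single (Fin.last k) 1)
      < lam + β ^ 2 * (Pi.single (Fin.last k) 1 ⬝ᵥ (T - lam • 1)⁻¹ *ᵥ Pi.single (Fin.last k) 1) := by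
  have hθlam (j) : lam < θ j := hlam.trans_le (hθ.monotone (Fin.zero_le j))
  rw [hspec, single_dotProduct_inv_mulVec_single hS θ fun j => (hμlam.trans (hθlam j)).ne',
    single_dotProduct_inv_mulVec_single hS θ fun j => (hθlam j).ne']
  have hpos (j) : 0 < θ j - lam := sub_pos.mpr (hθlam j)
  refine add_lt_add_of_lt_of_le hμlam ?_
  gcongr with j
  exact hpos j
end

section
/- Let T_{k+1} be the (k+1)×(k+1) Jacobi matrix whose leading k×k principal submatrix is T_k, whose (k+1,k) and (k,k+1) entries equal β_k > 0, and whose (k+1,k+1) entry is α_{k+1}, and let θ_1^{(k+1)} be the smallest eigenvalue of T_{k+1}. Then θ_1^{(k+1)} < θ_1^{(k)}, the identity α_{k+1} = θ_1^{(k+1)} + β_k² e_k^T (T_k − θ_1^{(k+1)} I)^{−1} e_k holds, and consequently for every μ < θ_1^{(k+1)} one has α_{k+1}^{(μ)} < α_{k+1}. -/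
open Matrix Finset

/-- An eigenvector of an irreducible symmetric tridiagonal matrix whose last entry vanishes is
zero. -/
lemma eq_zero_of_tridiagonal_mulVec_eq_smul {k : ℕ} {T : Matrix (Fin (k + 1)) (Fin (k + 1)) ℝ}
    (hsymm : T.IsSymm) (htri : ∀ i j : Fin (k + 1), (i : ℕ) + 1 < (j : ℕ) → T i j = 0)
    (hoff : ∀ i : Fin k, 0 < T i.castSucc i.succ) {v : Fin (k + 1) → ℝ} {c : ℝ}
    (hv : T *ᵥ v = c • v) (hlast : v (Fin.last k) = 0) : v = 0 := by
  have key : ∀ m : ℕ, ∀ i : Fin (k + 1), k ≤ (i : ℕ) + m → v i = 0 := by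
    intro m
    induction m with
    | zero =>
      intro i hi
      rwa [show i = Fin.last k from Fin.ext (by simp only [Fin.val_last]; omega)]
    | succ m ih =>
      intro i hi
      induction i using Fin.lastCases with
      | last => exact hlast
      | cast i =>
        have hrow := congrFun hv i.succ
        have hsucc : v i.succ = 0 := ih _ (by rw [Fin.val_castSucc] at hi; rw [Fin.val_succ]; omega)
        have hsum : (T *ᵥ v) i.succ = T i.succ i.castSucc * v i.castSucc := by
          refine Finset.sum_eq_single i.castSucc (fun j _ hj => ?_)
            (fun h => absurd (Finset.mem_univ _) h)
          change T i.succ j * v j = 0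
          rcases lt_or_gt_of_ne (Fin.val_ne_of_ne hj) with h | h
          · rw [← hsymm.apply, htri j i.succ (Nat.succ_lt_succ h), zero_mul]
          · rw [ih j (by rw [Fin.val_castSucc] at hi h; omega), mul_zero]
        rw [hsum, ← hsymm.apply, Pi.smul_apply, hsucc, smul_zero] at hrow
        exact (mul_eq_zero.mp hrow).resolve_left (hoff i).ne'
  exact funext fun i => key k i (by omega)

section OrthogonalDiagonalization

variable {n : Type*} [Fintype n] [DecidableEq n] {A S : Matrix n n ℝ} {d : n → ℝ}

lemma mulVec_col_of_orthogonal_diagonalization (hS : S * Sᵀ = 1) (hA : A = S * diagonal d * Sᵀ)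
    (j : n) : A *ᵥ S.col j = d j • S.col j := by
  have h : A * S = S * diagonal d := by
    rw [hA, Matrix.mul_assoc, mul_eq_one_comm.mp hS, Matrix.mul_one]
  ext i
  have hij := congrFun (congrFun h i) j
  rw [mul_diagonal] at hij
  rw [Pi.smul_apply, smul_eq_mul, mul_comm]
  exact hij

lemma col_dotProduct_col_self_of_orthogonal (hS : S * Sᵀ = 1) (j : n) :
    S.col j ⬝ᵥ S.col j = 1 := by
  have hS' : Sᵀ * S = 1 := mul_eq_one_comm.mp hS
  have h := congrFun (congrFun hS' j) j
  rw [one_apply_eq] at h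
  exact h

lemma dotProduct_mulVec_orthogonal_conj_diagonal (d : n → ℝ) (S : Matrix n n ℝ) (w : n → ℝ) :
    w ⬝ᵥ (S * diagonal d * Sᵀ) *ᵥ w = ∑ i, d i * (Sᵀ *ᵥ w) i ^ 2 := by
  rw [← mulVec_mulVec, ← mulVec_mulVec, dotProduct_mulVec, ← mulVec_transpose]
  simp only [dotProduct, mulVec_diagonal]
  exact Finset.sum_congr rfl fun i _ => by ring

lemma mul_dotProduct_self_le_of_orthogonal_diagonalization (hS : S * Sᵀ = 1)
    (hA : A = S * diagonal d * Sᵀ) {c : ℝ} (hc : ∀ i, c ≤ d i) (w : n → ℝ) :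
    c * (w ⬝ᵥ w) ≤ w ⬝ᵥ A *ᵥ w := by
  have h := dotProduct_mulVec_orthogonal_conj_diagonal (fun _ : n => (1 : ℝ)) S w
  rw [diagonal_one, Matrix.mul_one, hS, one_mulVec] at h
  rw [hA, dotProduct_mulVec_orthogonal_conj_diagonal, h, Finset.mul_sum]
  refine Finset.sum_le_sum fun i _ => ?_
  rw [one_mul]
  exact mul_le_mul_of_nonneg_right (hc i) (sq_nonneg _)

lemma sub_smul_one_mul_orthogonal_resolvent (hS : S * Sᵀ = 1) (hA : A = S * diagonal d * Sᵀ)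
    {μ : ℝ} (hμ : ∀ i, μ < d i) :
    (A - μ • 1) * (S * diagonal (fun i => (d i - μ)⁻¹) * Sᵀ) = 1 := by
  have hshift : A - μ • 1 = S * diagonal (fun i => d i - μ) * Sᵀ := by
    have hd : diagonal (fun i => d i - μ) = diagonal d - μ • (1 : Matrix n n ℝ) := by
      rw [smul_one_eq_diagonal, diagonal_sub]
    rw [hd, Matrix.mul_sub, Matrix.sub_mul, ← hA, Matrix.mul_smul, Matrix.smul_mul,
      Matrix.mul_one, hS]
  calc (A - μ • 1) * (S * diagonal (fun i => (d i - μ)⁻¹) * Sᵀ)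
      = S * (diagonal (fun i => d i - μ) * (Sᵀ * S) * diagonal (fun i => (d i - μ)⁻¹)) * Sᵀ := by
        rw [hshift]; simp only [Matrix.mul_assoc]
    _ = 1 := by
        have hone : (fun i => (d i - μ) * (d i - μ)⁻¹) = fun _ => 1 :=
          funext fun i => mul_inv_cancel₀ (sub_pos.mpr (hμ i)).ne'
        rw [mul_eq_one_comm.mp hS, Matrix.mul_one, diagonal_mul_diagonal, hone, diagonal_one,
          Matrix.mul_one, hS]

lemma dotProduct_resolvent_mulVec_mono (hS : S * Sᵀ = 1) (hA : A = S * diagonal d * Sᵀ)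
    {μ ν : ℝ} (hμν : μ ≤ ν) (hν : ∀ i, ν < d i) (w : n → ℝ) :
    w ⬝ᵥ (A - μ • 1)⁻¹ *ᵥ w ≤ w ⬝ᵥ (A - ν • 1)⁻¹ *ᵥ w := by
  have hμ : ∀ i, μ < d i := fun i => hμν.trans_lt (hν i)
  rw [inv_eq_right_inv (sub_smul_one_mul_orthogonal_resolvent hS hA hμ),
    inv_eq_right_inv (sub_smul_one_mul_orthogonal_resolvent hS hA hν),
    dotProduct_mulVec_orthogonal_conj_diagonal, dotProduct_mulVec_orthogonal_conj_diagonal]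
  refine Finset.sum_le_sum fun i _ => mul_le_mul_of_nonneg_right ?_ (sq_nonneg _)
  exact inv_anti₀ (sub_pos.mpr (hν i)) (sub_le_sub_left hμν _)

end OrthogonalDiagonalization

/-- for the extended Jacobi matrix `T'` (with bottom corner `αk1` and
off-diagonal `β > 0`) with smallest eigenvalue `θ' 0`, one has `θ' 0 < θ 0`,
`αk1 = θ' 0 + β² eᵀ(T - θ' 0 I)⁻¹ e`, and `α_{k+1}^{(μ)} < αk1` for every `μ < θ' 0`. -/
theorem stmt3
    (k : ℕ) (T S : Matrix (Fin (k + 1)) (Fin (k + 1)) ℝ)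
    (T' S' : Matrix (Fin (k + 2)) (Fin (k + 2)) ℝ)
    (θ : Fin (k + 1) → ℝ) (θ' : Fin (k + 2) → ℝ) (β αk1 : ℝ)
    (hsymm : T.IsSymm)
    (htri : ∀ i j : Fin (k + 1), (i : ℕ) + 1 < (j : ℕ) → T i j = 0)
    (hoff : ∀ i : Fin k, 0 < T i.castSucc i.succ)
    (hθ : StrictMono θ)
    (hS : S * Sᵀ = 1)
    (hspec : T = S * Matrix.diagonal θ * Sᵀ)
    (hβ : 0 < β)
    (hT'sub : ∀ i j : Fin (k + 1), T' i.castSucc j.castSucc = T i j)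
    (hT'β1 : T' (Fin.last (k + 1)) ((Fin.last k).castSucc) = β)
    (hT'β2 : T' ((Fin.last k).castSucc) (Fin.last (k + 1)) = β)
    (hT'α : T' (Fin.last (k + 1)) (Fin.last (k + 1)) = αk1)
    (hT'zero : ∀ i : Fin (k + 1), i ≠ Fin.last k →
      T' i.castSucc (Fin.last (k + 1)) = 0 ∧ T' (Fin.last (k + 1)) i.castSucc = 0)
    (hθ' : StrictMono θ')
    (hS' : S' * S'ᵀ = 1)
    (hspec' : T' = S' * Matrix.diagonal θ' * S'ᵀ) :
    θ' 0 < θ 0 ∧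
    αk1 = θ' 0 + β ^ 2 *
      (Pi.single (Fin.last k) 1 ⬝ᵥ (T - θ' 0 • 1)⁻¹ *ᵥ Pi.single (Fin.last k) 1) ∧
    ∀ μ : ℝ, μ < θ' 0 →
      μ + β ^ 2 * (Pi.single (Fin.last k) 1 ⬝ᵥ (T - μ • 1)⁻¹ *ᵥ Pi.single (Fin.last k) 1)
        < αk1 := by
  have hrow (u : Fin (k + 2) → ℝ) (i : Fin (k + 1)) : (T' *ᵥ u) i.castSucc =
      (T *ᵥ fun j => u j.castSucc) i +
        β * u (Fin.last (k + 1)) * (Pi.single (Fin.last k) 1 : Fin (k + 1) → ℝ) i := by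
    simp only [mulVec, dotProduct, Fin.sum_univ_castSucc (n := k + 1), hT'sub]
    by_cases hi : i = Fin.last k
    · subst hi; rw [hT'β2, Pi.single_eq_same, mul_one]
    · rw [(hT'zero i hi).1, Pi.single_eq_of_ne hi, zero_mul, mul_zero]
  have hrow_last (u : Fin (k + 2) → ℝ) : (T' *ᵥ u) (Fin.last (k + 1)) =
      β * u (Fin.last k).castSucc + αk1 * u (Fin.last (k + 1)) := by
    simp only [mulVec, dotProduct]
    rw [Fin.sum_univ_castSucc (n := k + 1), hT'α, Finset.sum_eq_single (Fin.last k), hT'β1]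
    · intro i _ hi; rw [(hT'zero i hi).2, zero_mul]
    · simp
  have hlt : θ' 0 < θ 0 := by
    by_contra! hle
    set v := S.col 0
    have hTv : T *ᵥ v = θ 0 • v := mulVec_col_of_orthogonal_diagonalization hS hspec 0
    have hvv : v ⬝ᵥ v = 1 := col_dotProduct_col_self_of_orthogonal hS 0
    have hvlast : v (Fin.last k) ≠ 0 := by
      intro h0
      rw [eq_zero_of_tridiagonal_mulVec_eq_smul hsymm htri hoff hTv h0] at hvv
      simp at hvv
    have hquad (t : ℝ) : 0 ≤ (αk1 - θ' 0) * (t * t) + (2 * β * v (Fin.last k)) * t + 0 := by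
      have hray := mul_dotProduct_self_le_of_orthogonal_diagonalization hS' hspec'
        (fun i => hθ'.monotone (Fin.zero_le i)) (Fin.snoc v t : Fin (k + 2) → ℝ)
      have hnorm : (Fin.snoc v t : Fin (k + 2) → ℝ) ⬝ᵥ (Fin.snoc v t : Fin (k + 2) → ℝ)
          = 1 + t * t := by
        rw [← hvv]
        simp [dotProduct, Fin.sum_univ_castSucc (n := k + 1)]
      have hform : (Fin.snoc v t : Fin (k + 2) → ℝ) ⬝ᵥ
          T' *ᵥ (Fin.snoc v t : Fin (k + 2) → ℝ)
          = θ 0 + 2 * β * v (Fin.last k) * t + αk1 * (t * t) := by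
        have hcross : ∑ i, v i * (T *ᵥ v) i = θ 0 := by
          change v ⬝ᵥ T *ᵥ v = _
          rw [hTv, dotProduct_smul, hvv, smul_eq_mul, mul_one]
        have hsingle : ∑ i, v i * (β * t * (Pi.single (Fin.last k) 1 : Fin (k + 1) → ℝ) i)
            = v (Fin.last k) * (β * t) := by
          rw [Finset.sum_eq_single (Fin.last k) (fun i _ hi => by simp [hi]) (by simp)]
          simp
        rw [dotProduct, Fin.sum_univ_castSucc (n := k + 1)]
        simp only [hrow, hrow_last, Fin.snoc_castSucc, Fin.snoc_last, mul_add,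
          Finset.sum_add_distrib]
        rw [hcross, hsingle]
        ring
      rw [hnorm, hform] at hray
      linarith
    have hdisc := discrim_le_zero hquad
    have hpos : 0 < (2 * β * v (Fin.last k)) ^ 2 := by positivity
    rw [discrim] at hdisc
    linarith
  have hlt' : ∀ i, θ' 0 < θ i := fun i => hlt.trans_le (hθ.monotone (Fin.zero_le i))
  have hcorner : αk1 = θ' 0 + β ^ 2 *
      (Pi.single (Fin.last k) 1 ⬝ᵥ (T - θ' 0 • 1)⁻¹ *ᵥ Pi.single (Fin.last k) 1) := by
    set u := S'.col 0
    set R := (T - θ' 0 • 1)⁻¹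
    set e : Fin (k + 1) → ℝ := Pi.single (Fin.last k) 1 with he
    set x : Fin (k + 1) → ℝ := fun j => u j.castSucc
    set y := u (Fin.last (k + 1)) with hy
    have hTu : T' *ᵥ u = θ' 0 • u := mulVec_col_of_orthogonal_diagonalization hS' hspec' 0
    have huu : u ⬝ᵥ u = 1 := col_dotProduct_col_self_of_orthogonal hS' 0
    have hinv : R * (T - θ' 0 • 1) = 1 := by
      have h := sub_smul_one_mul_orthogonal_resolvent hS hspec hlt'
      rw [show R = _ from inv_eq_right_inv h]
      exact mul_eq_one_comm.mp h
    have hshift : (T - θ' 0 • 1) *ᵥ x = (-(β * y)) • e := by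
      ext i
      have h := (hrow u i).symm.trans (congrFun hTu i.castSucc)
      simp only [sub_mulVec, smul_mulVec, one_mulVec, Pi.sub_apply, Pi.smul_apply,
        smul_eq_mul] at h ⊢
      linarith
    have hx : x = (-(β * y)) • R *ᵥ e := by
      rw [← mulVec_smul, ← hshift, mulVec_mulVec, hinv, one_mulVec]
    have hyne : y ≠ 0 := by
      intro hy0
      have hx0 : x = 0 := by rw [hx, hy0, mul_zero, neg_zero, zero_smul]
      rw [dotProduct, Fin.sum_univ_castSucc (n := k + 1), ← hy, hy0,
        Finset.sum_eq_zero fun i _ => by rw [show u i.castSucc = 0 from congrFun hx0 i, zero_mul]]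
        at huu
      simp at huu
    have hbot := (hrow_last u).symm.trans (congrFun hTu (Fin.last (k + 1)))
    have hxlast : u (Fin.last k).castSucc = -(β * y) * (e ⬝ᵥ R *ᵥ e) := by
      have h := congrFun hx (Fin.last k)
      rw [Pi.smul_apply, smul_eq_mul] at h
      rw [he, single_one_dotProduct]
      exact h
    rw [hxlast, Pi.smul_apply, smul_eq_mul, ← hy] at hbot
    apply mul_right_cancel₀ hyne
    linear_combination hbot
  refine ⟨hlt, hcorner, fun μ hμ => ?_⟩
  have hmono := dotProduct_resolvent_mulVec_mono hS hspec hμ.le hlt' (Pi.single (Fin.last k) 1)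
  rw [hcorner]
  exact add_lt_add_of_lt_of_le hμ (mul_le_mul_of_nonneg_left hmono (sq_nonneg β))
end

section
/- Let μ < λ < θ_1^{(k)}. Then for every i = 1,…,k, η_{i,k}^{(λ)} − η_{i,k}^{(μ)} = η_{i,k}^{(μ)} (λ − μ)/(θ_i^{(k)} − λ); moreover α_{k+1}^{(λ)} − α_{k+1}^{(μ)} = ((λ − μ)/(θ_1^{(k)} − μ)) η_{1,k}^{(λ)} + (λ − μ) E_k^{(λ,μ)}, where E_k^{(λ,μ)} := 1 + Σ_{i=2}^{k} η_{i,k}^{(λ)}/(θ_i^{(k)} − μ), and E_k^{(λ,μ)} = E_k^{(μ,λ)}. -/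
open Matrix Finset

/-- The resolvent of `S * diagonal θ * Sᵀ`, with `S` orthogonal, is diagonalized by `S`. -/
theorem inv_sub_smul_one_of_diagonalization {n : Type*} [Fintype n] [DecidableEq n]
    {S : Matrix n n ℝ} {θ : n → ℝ} (hS : S * Sᵀ = 1) {ν : ℝ} (hν : ∀ i, θ i ≠ ν) :
    (S * diagonal θ * Sᵀ - ν • 1)⁻¹ = S * diagonal (fun i => (θ i - ν)⁻¹) * Sᵀ := by
  have hS' : Sᵀ * S = 1 := mul_eq_one_comm.mp hS
  have hshift : S * diagonal θ * Sᵀ - ν • 1 = S * diagonal (fun i => θ i - ν) * Sᵀ := by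
    have hdiag : diagonal (fun i => θ i - ν) = diagonal θ - ν • (1 : Matrix n n ℝ) := by
      rw [smul_one_eq_diagonal, diagonal_sub]
    rw [hdiag, Matrix.mul_sub, Matrix.sub_mul, Matrix.mul_smul, Matrix.smul_mul, Matrix.mul_one,
      hS]
  have hdiag : diagonal (fun i => θ i - ν) * diagonal (fun i => (θ i - ν)⁻¹) = 1 := by
    rw [diagonal_mul_diagonal, ← diagonal_one]
    congr 1
    funext i
    exact mul_inv_cancel₀ (sub_ne_zero.mpr (hν i))
  apply inv_eq_right_inv
  calc (S * diagonal θ * Sᵀ - ν • 1) * (S * diagonal (fun i => (θ i - ν)⁻¹) * Sᵀ)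
      = S * (diagonal (fun i => θ i - ν) * (Sᵀ * S) * diagonal (fun i => (θ i - ν)⁻¹)) * Sᵀ := by
        rw [hshift]; simp only [Matrix.mul_assoc]
    _ = 1 := by rw [hS', Matrix.mul_one, hdiag, Matrix.mul_one, hS]

/-- Spectral expansion of a diagonal entry of the resolvent. -/
theorem single_dotProduct_inv_sub_smul_one_mulVec_single {n : Type*} [Fintype n] [DecidableEq n]
    {S : Matrix n n ℝ} {θ : n → ℝ} (hS : S * Sᵀ = 1) {ν : ℝ} (hν : ∀ i, θ i ≠ ν) (j : n) :
    Pi.single j 1 ⬝ᵥ (S * diagonal θ * Sᵀ - ν • 1)⁻¹ *ᵥ Pi.single j 1 =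
      ∑ i, S j i ^ 2 / (θ i - ν) := by
  rw [inv_sub_smul_one_of_diagonalization hS hν, mulVec_single_one, single_one_dotProduct,
    col_apply, mul_apply]
  refine Finset.sum_congr rfl fun i _ => ?_
  rw [mul_diagonal, transpose_apply]
  ring

/-- Lemma 2: for `μ < λ < θ 0`,
`η_{i,k}^{(λ)} - η_{i,k}^{(μ)} = η_{i,k}^{(μ)} (λ-μ)/(θᵢ - λ)`,
`α_{k+1}^{(λ)} - α_{k+1}^{(μ)} = ((λ-μ)/(θ₁-μ)) η_{1,k}^{(λ)} + (λ-μ) E_k^{(λ,μ)}`,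
and `E_k^{(λ,μ)} = E_k^{(μ,λ)}`. -/
theorem stmt4
    (k : ℕ) (T S : Matrix (Fin (k + 1)) (Fin (k + 1)) ℝ)
    (θ : Fin (k + 1) → ℝ) (β μ lam : ℝ)
    (hsymm : T.IsSymm)
    (htri : ∀ i j : Fin (k + 1), (i : ℕ) + 1 < (j : ℕ) → T i j = 0)
    (hoff : ∀ i : Fin k, 0 < T i.castSucc i.succ)
    (hθ : StrictMono θ)
    (hS : S * Sᵀ = 1)
    (hspec : T = S * Matrix.diagonal θ * Sᵀ)
    (hβ : 0 < β) (hμlam : μ < lam) (hlam : lam < θ 0)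
    (η : ℝ → Fin (k + 1) → ℝ)
    (hη : ∀ ν i, η ν i = (β * S (Fin.last k) i) ^ 2 / (θ i - ν))
    (αμ αlam : ℝ)
    (hαμ : αμ = μ + β ^ 2 *
      (Pi.single (Fin.last k) 1 ⬝ᵥ (T - μ • 1)⁻¹ *ᵥ Pi.single (Fin.last k) 1))
    (hαlam : αlam = lam + β ^ 2 *
      (Pi.single (Fin.last k) 1 ⬝ᵥ (T - lam • 1)⁻¹ *ᵥ Pi.single (Fin.last k) 1))
    (E : ℝ → ℝ → ℝ)
    (hE : ∀ ν ξ : ℝ, E ν ξ = 1 + ∑ i ∈ Finset.Ioi (0 : Fin (k + 1)), η ν i / (θ i - ξ)) :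
    (∀ i, η lam i - η μ i = η μ i * ((lam - μ) / (θ i - lam))) ∧
    αlam - αμ = ((lam - μ) / (θ 0 - μ)) * η lam 0 + (lam - μ) * E lam μ ∧
    E lam μ = E μ lam := by
  have hθ0 (i) : θ 0 ≤ θ i := hθ.monotone (Fin.zero_le i)
  have hl (i) : θ i - lam ≠ 0 := by linarith [hθ0 i]
  have hm (i) : θ i - μ ≠ 0 := by linarith [hθ0 i]
  have hdiff (i) : η lam i - η μ i = (lam - μ) * (η lam i / (θ i - μ)) := by
    have := hl i
    have := hm i
    rw [hη, hη]
    field_simp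
    ring
  have hα (ν : ℝ) (hν : ∀ i, θ i - ν ≠ 0) : β ^ 2 * (Pi.single (Fin.last k) 1 ⬝ᵥ
      (T - ν • 1)⁻¹ *ᵥ Pi.single (Fin.last k) 1) = ∑ i, η ν i := by
    rw [hspec, single_dotProduct_inv_sub_smul_one_mulVec_single hS fun i => sub_ne_zero.mp (hν i),
      Finset.mul_sum]
    refine Finset.sum_congr rfl fun i _ => ?_
    rw [hη, mul_pow, mul_div_assoc]
  refine ⟨fun i => ?_, ?_, ?_⟩
  · have := hl i
    have := hm i
    rw [hη, hη]
    field_simp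
    ring
  · have hsplit (f : Fin (k + 1) → ℝ) : ∑ i, f i = f 0 + ∑ i ∈ Finset.Ioi 0, f i := by
      rw [Fin.sum_univ_succ, Fin.sum_Ioi_zero]
    have hsum : ∑ i, η lam i - ∑ i, η μ i = (lam - μ) * ∑ i, η lam i / (θ i - μ) := by
      rw [← Finset.sum_sub_distrib, Finset.mul_sum]
      exact Finset.sum_congr rfl fun i _ => hdiff i
    rw [hsplit fun i => η lam i / (θ i - μ)] at hsum
    rw [hαlam, hαμ, hα lam hl, hα μ hm, hE]
    linear_combination hsum
  · rw [hE, hE]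
    congr 1
    refine Finset.sum_congr rfl fun i _ => ?_
    rw [hη, hη, div_right_comm]
end

section
/- Let T_{k−1} denote the leading (k−1)×(k−1) principal submatrix of the Jacobi matrix T_k, with eigenvalues θ_1^{(k−1)} < ⋯ < θ_{k−1}^{(k−1)}. Then the squared last component of the normalized eigenvector of T_k corresponding to its smallest eigenvalue θ_1^{(k)} satisfies (s_{k,1}^{(k)})² = Π_{i=1}^{k−1} (θ_i^{(k−1)} − θ_1^{(k)})/(θ_{i+1}^{(k)} − θ_1^{(k)}), and every factor in this product is positive (by the strict interlacing of the eigenvalues of T_{k−1} and T_k). -/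
open Matrix Finset

/-- Adjugates commute with orthogonal conjugation. -/
lemma adjugate_orthogonal_conj {n : Type*} [Fintype n] [DecidableEq n] {S : Matrix n n ℝ}
    (hS : S * Sᵀ = 1) (A : Matrix n n ℝ) :
    (S * A * Sᵀ).adjugate = S * A.adjugate * Sᵀ := by
  have hdet : S.det * S.det = 1 := by
    have := congrArg det hS
    rwa [det_mul, det_transpose, det_one] at this
  have hadj : S.adjugate = S.det • Sᵀ := by
    calc S.adjugate = S.adjugate * (S * Sᵀ) := by rw [hS, mul_one]
      _ = S.det • Sᵀ := by rw [← mul_assoc, adjugate_mul, smul_mul_assoc, one_mul]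
  rw [adjugate_mul_distrib, adjugate_mul_distrib, ← adjugate_transpose, hadj]
  simp [smul_smul, hdet, mul_assoc]

/-- The shift by a scalar passes through an orthogonal diagonalization. -/
lemma orthogonal_conj_diagonal_sub {n : Type*} [Fintype n] [DecidableEq n] {S : Matrix n n ℝ}
    (hS : S * Sᵀ = 1) (d : n → ℝ) (c : ℝ) :
    S * diagonal d * Sᵀ - c • 1 = S * diagonal (fun i => d i - c) * Sᵀ := by
  have : diagonal (fun i => d i - c) = diagonal d - c • (1 : Matrix n n ℝ) := by
    ext i j
    by_cases h : i = j <;> simp [h, one_apply]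
  rw [this, mul_sub, sub_mul, mul_smul_comm, mul_one, smul_mul_assoc, hS]

/-- The last diagonal entry of the adjugate is the leading principal minor. -/
lemma adjugate_last_last {k : ℕ} (A : Matrix (Fin (k + 1)) (Fin (k + 1)) ℝ) :
    A.adjugate (Fin.last k) (Fin.last k) = (A.submatrix Fin.castSucc Fin.castSucc).det := by
  rw [adjugate_fin_succ_eq_det_submatrix, Fin.succAbove_last, Even.neg_one_pow ⟨_, rfl⟩, one_mul]

/-- The smallest eigenvalue of a Jacobi matrix lies strictly below every eigenvalue of its leading
principal submatrix. -/
lemma smallest_eigenvalue_lt_of_leading_submatrix {k : ℕ}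
    {T S : Matrix (Fin (k + 1)) (Fin (k + 1)) ℝ} {θ : Fin (k + 1) → ℝ}
    (hsymm : T.IsSymm)
    (htri : ∀ i j : Fin (k + 1), (i : ℕ) + 1 < (j : ℕ) → T i j = 0)
    (hoff : ∀ i : Fin k, 0 < T i.castSucc i.succ)
    (hθ : Monotone θ) (hS : S * Sᵀ = 1) (hspec : T = S * diagonal θ * Sᵀ)
    {p : Fin k → ℝ} {μ : ℝ} (hp : p ≠ 0)
    (hμ : T.submatrix Fin.castSucc Fin.castSucc *ᵥ p = μ • p) :
    θ 0 < μ := by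
  by_contra! hle
  set v : Fin (k + 1) → ℝ := Fin.snoc p 0 with hvdef
  have hvc (a : Fin k) : v a.castSucc = p a := by simp [hvdef]
  have hvl : v (Fin.last k) = 0 := by simp [hvdef]
  have hquad : v ⬝ᵥ T *ᵥ v = μ * (v ⬝ᵥ v) := by
    have hrow (a : Fin k) : (T *ᵥ v) a.castSucc = μ * p a := by
      have := congrFun hμ a
      simp only [mulVec, dotProduct, submatrix_apply, Pi.smul_apply, smul_eq_mul] at this
      rw [mulVec, dotProduct, Fin.sum_univ_castSucc]
      simp [hvc, hvl, this]
    simp only [dotProduct, Fin.sum_univ_castSucc, hvc, hvl, hrow, mul_sum, zero_mul, add_zero]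
    exact sum_congr rfl fun a _ => by ring
  set w := Sᵀ *ᵥ v with hw
  have hSw : S *ᵥ w = v := by rw [hw, mulVec_mulVec, hS, one_mulVec]
  have hshift : (T - θ 0 • 1) *ᵥ v = S *ᵥ fun j => (θ j - θ 0) * w j := by
    rw [hspec, orthogonal_conj_diagonal_sub hS, ← mulVec_mulVec, ← mulVec_mulVec, ← hw]
    congr 1
    funext j
    rw [mulVec_diagonal]
  have hsum : ∑ j, (θ j - θ 0) * w j ^ 2 = (μ - θ 0) * (v ⬝ᵥ v) := by
    have h1 : v ⬝ᵥ (T - θ 0 • 1) *ᵥ v = (μ - θ 0) * (v ⬝ᵥ v) := by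
      rw [sub_mulVec, dotProduct_sub, hquad, smul_mulVec, one_mulVec, dotProduct_smul,
        smul_eq_mul, sub_mul]
    rw [← h1, hshift, dotProduct_mulVec, ← mulVec_transpose, ← hw, dotProduct]
    exact sum_congr rfl fun j _ => by ring
  have hnn : ∀ j ∈ univ, 0 ≤ (θ j - θ 0) * w j ^ 2 := fun j _ =>
    mul_nonneg (sub_nonneg.mpr (hθ (Fin.zero_le j))) (sq_nonneg _)
  have hvv : 0 ≤ v ⬝ᵥ v := sum_nonneg fun j _ => mul_self_nonneg (v j)
  have hzero : ∑ j, (θ j - θ 0) * w j ^ 2 = 0 :=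
    le_antisymm (hsum ▸ mul_nonpos_of_nonpos_of_nonneg (sub_nonpos.mpr hle) hvv)
      (sum_nonneg hnn)
  have hker : (fun j => (θ j - θ 0) * w j) = 0 := by
    funext j
    have := (sum_eq_zero_iff_of_nonneg hnn).mp hzero j (mem_univ j)
    simpa using this
  have hTv : T *ᵥ v = θ 0 • v := by
    rw [hker, mulVec_zero, sub_mulVec, smul_mulVec, one_mulVec] at hshift
    exact sub_eq_zero.mp hshift
  have hv0 := eq_zero_of_tridiagonal_mulVec_eq_smul hsymm htri hoff hTv hvl
  exact hp (funext fun a => by rw [← hvc, hv0]; rfl)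


/-- the squared last component of the normalized eigenvector of the Jacobi
matrix `T` for its smallest eigenvalue `θ 0` equals
`∏ᵢ (θ'ᵢ - θ 0)/(θ_{i+1} - θ 0)`, where `θ'` are the eigenvalues of the leading principal
submatrix, and every numerator and denominator in the product is positive
(strict interlacing). -/
theorem stmt5
    (k : ℕ) (T S : Matrix (Fin (k + 1)) (Fin (k + 1)) ℝ)
    (P : Matrix (Fin k) (Fin k) ℝ)
    (θ : Fin (k + 1) → ℝ) (θ' : Fin k → ℝ)
    (hsymm : T.IsSymm)
    (htri : ∀ i j : Fin (k + 1), (i : ℕ) + 1 < (j : ℕ) → T i j = 0)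
    (hoff : ∀ i : Fin k, 0 < T i.castSucc i.succ)
    (hθ : StrictMono θ)
    (hS : S * Sᵀ = 1)
    (hspec : T = S * Matrix.diagonal θ * Sᵀ)
    (hθ' : StrictMono θ')
    (hP : P * Pᵀ = 1)
    (hspec' : T.submatrix Fin.castSucc Fin.castSucc = P * Matrix.diagonal θ' * Pᵀ) :
    (S (Fin.last k) 0) ^ 2 = ∏ i : Fin k, (θ' i - θ 0) / (θ i.succ - θ 0) ∧
    ∀ i : Fin k, 0 < θ' i - θ 0 ∧ 0 < θ i.succ - θ 0 := by
  have hden (i : Fin k) : 0 < θ i.succ - θ 0 := sub_pos.mpr (hθ (Fin.succ_pos i))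
  have hPt : Pᵀ * P = 1 := mul_eq_one_comm.mp hP
  have hnum (i : Fin k) : 0 < θ' i - θ 0 := by
    refine sub_pos.mpr (smallest_eigenvalue_lt_of_leading_submatrix hsymm htri hoff hθ.monotone
      hS hspec (p := P *ᵥ Pi.single i 1) (fun h => ?_) ?_)
    · have h1 := congrArg (Pᵀ *ᵥ ·) h
      simp only [mulVec_mulVec, hPt, one_mulVec, mulVec_zero] at h1
      simpa using congrFun h1 i
    · rw [hspec', mulVec_mulVec, mul_assoc, hPt, mul_one, ← mulVec_mulVec, ← mulVec_smul]
      congr 1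
      funext j
      rw [mulVec_diagonal]
      by_cases h : j = i <;> simp [h]
  refine ⟨?_, fun i => ⟨hnum i, hden i⟩⟩
  have hminor : ((T - θ 0 • 1).submatrix Fin.castSucc Fin.castSucc).det
      = ∏ i, (θ' i - θ 0) := by
    have : (T - θ 0 • 1).submatrix Fin.castSucc Fin.castSucc
        = T.submatrix Fin.castSucc Fin.castSucc - θ 0 • 1 := by
      ext a b
      simp [one_apply]
    rw [this, hspec', orthogonal_conj_diagonal_sub hP, det_mul_right_comm, hP, one_mul,
      det_diagonal]
  have hadj : (T - θ 0 • 1).adjugate (Fin.last k) (Fin.last k)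
      = S (Fin.last k) 0 ^ 2 * ∏ i : Fin k, (θ i.succ - θ 0) := by
    have herase : (univ.erase (0 : Fin (k + 1))) = univ.image Fin.succ := by
      ext j
      simp
    rw [hspec, orthogonal_conj_diagonal_sub hS, adjugate_orthogonal_conj hS, adjugate_diagonal,
      mul_apply, Finset.sum_eq_single 0]
    · rw [mul_diagonal, herase, prod_image (Fin.succ_injective k).injOn, transpose_apply]
      ring
    · intro j _ hj
      rw [mul_diagonal, prod_eq_zero (mem_erase.mpr ⟨hj.symm, mem_univ 0⟩) (sub_self _)]
      simp
    · simp
  rw [prod_div_distrib, eq_div_iff (prod_pos fun i _ => hden i).ne', ← hadj, adjugate_last_last,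
    hminor]
end

section
/- Suppose A V_k = V_k T_k + β_k v_{k+1} e_k^T, where A is an N×N real symmetric matrix with simple eigenvalues λ_1 < λ_2 < ⋯ < λ_N, V_k is an N×k matrix with orthonormal columns, v_{k+1} ∈ ℝ^N is a unit vector orthogonal to the columns of V_k, β_k > 0, and T_k is symmetric. Let θ_1^{(k)} be the smallest eigenvalue of T_k with unit eigenvector s whose last component is s_{k,1}^{(k)}. If λ_1 is the eigenvalue of A closest to θ_1^{(k)} and λ_1 < θ_1^{(k)} < λ_2, then (β_k s_{k,1}^{(k)})²/(λ_N − λ_1) ≤ θ_1^{(k)} − λ_1 ≤ (β_k s_{k,1}^{(k)})²/(λ_2 − θ_1^{(k)}), and consequently λ_2 − θ_1^{(k)} ≤ (β_k s_{k,1}^{(k)})²/(θ_1^{(k)} − λ_1) ≤ λ_N − λ_1. -/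
open Matrix Finset

/-- The residual relation `(lam i - θ) c i = ρ w i`, with `c`, `w` orthonormal, determines the
quadratic form of `(A - a)(A - b)` at `c` in an eigenbasis of `A`. -/
theorem sum_sub_mul_sub_mul_sq {ι : Type*} [Fintype ι] {lam c w : ι → ℝ} {θ ρ : ℝ}
    (hc : c ⬝ᵥ c = 1) (hw : w ⬝ᵥ w = 1) (hwc : w ⬝ᵥ c = 0)
    (h : ∀ i, lam i * c i = θ * c i + ρ * w i) (a b : ℝ) :
    ∑ i, (lam i - a) * (lam i - b) * c i ^ 2 = ρ ^ 2 + (θ - a) * (θ - b) := by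
  have key (i : ι) : (lam i - a) * (lam i - b) * c i ^ 2 =
      ρ ^ 2 * (w i * w i) + ρ * ((θ - a) + (θ - b)) * (w i * c i) +
        (θ - a) * (θ - b) * (c i * c i) := by
    calc (lam i - a) * (lam i - b) * c i ^ 2
        = (lam i * c i - a * c i) * (lam i * c i - b * c i) := by ring
      _ = _ := by rw [h i]; ring
  simp only [dotProduct] at hc hw hwc
  simp_rw [key, Finset.sum_add_distrib, ← Finset.mul_sum, hc, hw, hwc]
  ring

/-- A matrix with orthonormal columns preserves dot products. -/
theorem mulVec_dotProduct_mulVec_of_transpose_mul_self {m n : Type*} [Fintype m] [Fintype n]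
    [DecidableEq n] {U : Matrix m n ℝ} (hU : Uᵀ * U = 1) (x y : n → ℝ) :
    (U *ᵥ x) ⬝ᵥ (U *ᵥ y) = x ⬝ᵥ y := by
  rw [dotProduct_mulVec, ← mulVec_transpose, mulVec_mulVec, hU, one_mulVec]

/-- Lanczos relation with `v` orthogonal to the columns of `V`; if `θ` is
the smallest eigenvalue of `T` with unit eigenvector `s` (last component `s_k`),
`λ 0` is the eigenvalue of `A` closest to `θ`, and `λ 0 < θ < λ 1`, then
`(β s_k)²/(λ_N - λ 0) ≤ θ - λ 0 ≤ (β s_k)²/(λ 1 - θ)`, and consequently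
`λ 1 - θ ≤ (β s_k)²/(θ - λ 0) ≤ λ_N - λ 0`. -/
theorem stmt7
    (N k : ℕ) (A Q : Matrix (Fin (N + 2)) (Fin (N + 2)) ℝ)
    (lam : Fin (N + 2) → ℝ)
    (V : Matrix (Fin (N + 2)) (Fin (k + 1)) ℝ) (v : Fin (N + 2) → ℝ)
    (T : Matrix (Fin (k + 1)) (Fin (k + 1)) ℝ) (β θ : ℝ) (s : Fin (k + 1) → ℝ)
    (hlam : StrictMono lam) (hQ : Q * Qᵀ = 1) (hAspec : A = Q * Matrix.diagonal lam * Qᵀ)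
    (hV : Vᵀ * V = 1) (hv : v ⬝ᵥ v = 1) (hvV : v ᵥ* V = 0)
    (hβ : 0 < β) (hT : T.IsSymm)
    (hLanczos : A * V = V * T + β • Matrix.vecMulVec v (Pi.single (Fin.last k) 1))
    (hs : s ⬝ᵥ s = 1) (heig : T *ᵥ s = θ • s)
    (hsmall : ∀ (c : ℝ) (w : Fin (k + 1) → ℝ), w ≠ 0 → T *ᵥ w = c • w → θ ≤ c)
    (hclosest : ∀ i, |lam 0 - θ| ≤ |lam i - θ|)
    (h1 : lam 0 < θ) (h2 : θ < lam 1) :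
    ((β * s (Fin.last k)) ^ 2 / (lam (Fin.last (N + 1)) - lam 0) ≤ θ - lam 0 ∧
      θ - lam 0 ≤ (β * s (Fin.last k)) ^ 2 / (lam 1 - θ)) ∧
    (lam 1 - θ ≤ (β * s (Fin.last k)) ^ 2 / (θ - lam 0) ∧
      (β * s (Fin.last k)) ^ 2 / (θ - lam 0) ≤ lam (Fin.last (N + 1)) - lam 0) := by
  have hQt : Qᵀᵀ * Qᵀ = 1 := by rw [transpose_transpose, hQ]
  set ρ := β * s (Fin.last k)
  have hres : A *ᵥ (V *ᵥ s) = θ • (V *ᵥ s) + ρ • v := by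
    rw [mulVec_mulVec, hLanczos, add_mulVec, ← mulVec_mulVec, heig, mulVec_smul, smul_mulVec,
      vecMulVec_mulVec, single_one_dotProduct, op_smul_eq_smul, smul_smul]
  have hdiag : diagonal lam *ᵥ (Qᵀ *ᵥ (V *ᵥ s)) =
      θ • (Qᵀ *ᵥ (V *ᵥ s)) + ρ • (Qᵀ *ᵥ v) := by
    have hQA : diagonal lam * Qᵀ = Qᵀ * A := by
      rw [hAspec, Matrix.mul_assoc, ← Matrix.mul_assoc, mul_eq_one_comm.mp hQ, Matrix.one_mul]
    rw [mulVec_mulVec, hQA, ← mulVec_mulVec, hres, mulVec_add, mulVec_smul _ θ, mulVec_smul _ ρ]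
  have hsum := sum_sub_mul_sub_mul_sq (lam := lam) (c := Qᵀ *ᵥ (V *ᵥ s)) (w := Qᵀ *ᵥ v)
    (θ := θ) (ρ := ρ)
    (by rw [mulVec_dotProduct_mulVec_of_transpose_mul_self hQt,
      mulVec_dotProduct_mulVec_of_transpose_mul_self hV, hs])
    (by rw [mulVec_dotProduct_mulVec_of_transpose_mul_self hQt, hv])
    (by rw [mulVec_dotProduct_mulVec_of_transpose_mul_self hQt, dotProduct_mulVec, hvV,
      zero_dotProduct])
    (fun i => by simpa [mulVec_diagonal] using congrFun hdiag i)
  have hlower : 0 ≤ ρ ^ 2 + (θ - lam 0) * (θ - lam 1) := by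
    rw [← hsum]
    refine Finset.sum_nonneg fun i _ => mul_nonneg ?_ (sq_nonneg _)
    obtain rfl | hi := eq_or_ne i 0
    · simp
    · have hi1 : (1 : Fin (N + 2)) ≤ i := Fin.one_le_of_ne_zero hi
      exact mul_nonneg (sub_nonneg.2 (hlam.monotone (Fin.zero_le i)))
        (sub_nonneg.2 (hlam.monotone hi1))
  have hupper : ρ ^ 2 + (θ - lam 0) * (θ - lam (Fin.last (N + 1))) ≤ 0 := by
    rw [← hsum]
    refine Finset.sum_nonpos fun i _ => mul_nonpos_of_nonpos_of_nonneg ?_ (sq_nonneg _)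
    exact mul_nonpos_of_nonneg_of_nonpos (sub_nonneg.2 (hlam.monotone (Fin.zero_le i)))
      (sub_nonpos.2 (hlam.monotone (Fin.le_last i)))
  have h0 : 0 < θ - lam 0 := sub_pos.2 h1
  have h12 : 0 < lam 1 - θ := sub_pos.2 h2
  have hN : lam 1 ≤ lam (Fin.last (N + 1)) := hlam.monotone (Fin.le_last 1)
  have hN0 : 0 < lam (Fin.last (N + 1)) - lam 0 := by linarith
  refine ⟨⟨?_, ?_⟩, ?_, ?_⟩
  · rw [div_le_iff₀ hN0]; nlinarith
  · rw [le_div_iff₀ h12]; nlinarith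
  · rw [le_div_iff₀ h0]; nlinarith
  · rw [div_le_iff₀ h0]; nlinarith
end

section
/- Let γ_0,…,γ_{k−1}, δ_1,…,δ_k be positive reals, let T_k = L_k D_k L_k^T be the Jacobi matrix built from γ_0,…,γ_{k−1} and δ_1,…,δ_{k−1} (so L_k is unit lower bidiagonal with subdiagonal √δ_1,…,√δ_{k−1} and D_k = diag(γ_0^{−1},…,γ_{k−1}^{−1})), and set β_k = √δ_k/γ_{k−1}. Let μ < θ_1^{(k)} (the smallest eigenvalue of T_k), set α_{k+1}^{(μ)} = μ + β_k² e_k^T (T_k − μ I)^{−1} e_k, assume α_{k+1}^{(μ)} − δ_k/γ_{k−1} ≠ 0, and define γ_k^{(μ)} = (α_{k+1}^{(μ)} − δ_k/γ_{k−1})^{−1}. Let T_{k+1}^{(μ)} be the (k+1)×(k+1) symmetric tridiagonal matrix extending T_k by off-diagonal entry β_k and bottom diagonal entry α_{k+1}^{(μ)}, and let L_{k+1} be the unit lower bidiagonal matrix with subdiagonal entries √δ_1,…,√δ_k. Then T_{k+1}^{(μ)} = L_{k+1} diag(D_k, (γ_k^{(μ)})^{−1}) L_{k+1}^T. -/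
open Matrix Finset

theorem mul_diagonal_mul_transpose_apply {n R : Type*} [Fintype n] [DecidableEq n]
    [NonUnitalNonAssocSemiring R] (A : Matrix n n R) (d : n → R) (i j : n) :
    (A * Matrix.diagonal d * Aᵀ) i j = ∑ l, A i l * d l * A j l := by
  simp [Matrix.mul_apply (M := A * Matrix.diagonal d), Matrix.mul_diagonal]

/-- the modified extended matrix `T'` (leading block `T = L D Lᵀ`,
off-diagonal `β_k = √δ_k/γ_{k-1}`, bottom corner `α_{k+1}^{(μ)}`) admits the modified
factorization `T' = L' diag(D, (γ_k^{(μ)})⁻¹) L'ᵀ`. -/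
theorem stmt9
    (k : ℕ) (γ : Fin (k + 1) → ℝ) (δ : Fin k → ℝ) (δk μ : ℝ)
    (hγ : ∀ i, 0 < γ i) (hδ : ∀ i, 0 < δ i) (hδk : 0 < δk)
    (L T : Matrix (Fin (k + 1)) (Fin (k + 1)) ℝ)
    (hLdiag : ∀ i, L i i = 1)
    (hLsub : ∀ i : Fin k, L i.succ i.castSucc = Real.sqrt (δ i))
    (hLzero : ∀ i j : Fin (k + 1), (i : ℕ) ≠ (j : ℕ) → (i : ℕ) ≠ (j : ℕ) + 1 → L i j = 0)
    (hT : T = L * Matrix.diagonal (fun i => (γ i)⁻¹) * Lᵀ)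
    -- `μ < θ 0`, the smallest eigenvalue of `T`:
    (hμ : (T - μ • 1).PosDef)
    (β : ℝ) (hβ : β = Real.sqrt δk / γ (Fin.last k))
    (αμ : ℝ)
    (hαμ : αμ = μ + β ^ 2 *
      (Pi.single (Fin.last k) 1 ⬝ᵥ (T - μ • 1)⁻¹ *ᵥ Pi.single (Fin.last k) 1))
    (hne : αμ - δk / γ (Fin.last k) ≠ 0)
    (γμ : ℝ) (hγμ : γμ = (αμ - δk / γ (Fin.last k))⁻¹)
    (T' L' : Matrix (Fin (k + 2)) (Fin (k + 2)) ℝ)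
    (hT'sub : ∀ i j : Fin (k + 1), T' i.castSucc j.castSucc = T i j)
    (hT'β1 : T' (Fin.last (k + 1)) ((Fin.last k).castSucc) = β)
    (hT'β2 : T' ((Fin.last k).castSucc) (Fin.last (k + 1)) = β)
    (hT'α : T' (Fin.last (k + 1)) (Fin.last (k + 1)) = αμ)
    (hT'zero : ∀ i : Fin (k + 1), i ≠ Fin.last k →
      T' i.castSucc (Fin.last (k + 1)) = 0 ∧ T' (Fin.last (k + 1)) i.castSucc = 0)
    (hL'diag : ∀ i, L' i i = 1)
    (hL'sub : ∀ i : Fin (k + 1), L' i.succ i.castSucc =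
      (Fin.snoc (fun j : Fin k => Real.sqrt (δ j)) (Real.sqrt δk) : Fin (k + 1) → ℝ) i)
    (hL'zero : ∀ i j : Fin (k + 2), (i : ℕ) ≠ (j : ℕ) → (i : ℕ) ≠ (j : ℕ) + 1 → L' i j = 0) :
    T' = L' * Matrix.diagonal
      (Fin.snoc (fun i : Fin (k + 1) => (γ i)⁻¹) γμ⁻¹ : Fin (k + 2) → ℝ) * L'ᵀ := by
  have hblock : ∀ i j : Fin (k + 1), L' i.castSucc j.castSucc = L i j := by
    intro i j
    by_cases h₁ : (i : ℕ) = j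
    · obtain rfl := Fin.ext h₁
      rw [hL'diag, hLdiag]
    by_cases h₂ : (i : ℕ) = j + 1
    · obtain ⟨m, rfl⟩ : ∃ m : Fin k, j = m.castSucc := ⟨⟨j, by omega⟩, rfl⟩
      obtain rfl : i = m.succ := Fin.ext h₂
      have h := hL'sub m.castSucc
      rw [Fin.snoc_castSucc] at h
      rw [hLsub, ← h]
      rfl
    · rw [hLzero i j h₁ h₂, hL'zero _ _ (by simpa using h₁) (by simpa using h₂)]
  have hcol : ∀ i : Fin (k + 1), L' i.castSucc (Fin.last (k + 1)) = 0 := by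
    intro i
    apply hL'zero <;> simp <;> omega
  have hrow : ∀ j : Fin (k + 1),
      L' (Fin.last (k + 1)) j.castSucc = if j = Fin.last k then √δk else 0 := by
    intro j
    split_ifs with h
    · subst h
      simpa using hL'sub (Fin.last k)
    · have hj : (j : ℕ) ≠ k := fun e => h (Fin.ext e)
      apply hL'zero <;> simp <;> omega
  have hLlast : ∀ i : Fin (k + 1), L i (Fin.last k) = if i = Fin.last k then 1 else 0 := by
    intro i
    split_ifs with h
    · rw [h, hLdiag]
    · have hi : (i : ℕ) ≠ k := fun e => h (Fin.ext e)
      apply hLzero <;> simp <;> omega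
  have hinv : γμ⁻¹ = αμ - δk / γ (Fin.last k) := by rw [hγμ, inv_inv]
  have hsq : √δk * √δk = δk := Real.mul_self_sqrt hδk.le
  ext i j
  rw [mul_diagonal_mul_transpose_apply, Fin.sum_univ_castSucc]
  simp only [Fin.snoc_castSucc, Fin.snoc_last]
  refine Fin.lastCases ?_ (fun i => ?_) i <;> refine Fin.lastCases ?_ (fun j => ?_) j
  · simp only [hrow, hL'diag, hT'α, hinv]
    simp only [ite_mul, mul_ite, zero_mul, mul_zero, Finset.sum_ite_eq', Finset.mem_univ, if_true]
    rw [mul_right_comm, hsq]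
    ring
  · simp only [hrow, hcol, hblock]
    simp only [ite_mul, zero_mul, mul_zero, Finset.sum_ite_eq', Finset.mem_univ, if_true, hLlast]
    split_ifs with h
    · rw [h, hT'β1, hβ]
      ring
    · rw [(hT'zero j h).2]
      ring
  · simp only [hrow, hcol, hblock]
    simp only [mul_ite, zero_mul, mul_zero, Finset.sum_ite_eq', Finset.mem_univ, if_true, hLlast]
    split_ifs with h
    · rw [h, hT'β2, hβ]
      ring
    · rw [(hT'zero i h).1]
      ring
  · simp only [hcol, hblock, hT'sub, hT, mul_diagonal_mul_transpose_apply]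
    ring
end

section
/- Let T_k be a k×k Jacobi matrix (symmetric tridiagonal with diagonal entries α_1,…,α_k and positive off-diagonal entries β_1,…,β_{k−1}), let T_j denote its leading j×j principal submatrices with smallest eigenvalues θ_1^{(j)}, and let μ < θ_1^{(j)} for all j = 1,…,k. Define α_1^{(μ)} = μ and, for j ≥ 2, α_j^{(μ)} = μ + β_{j−1}² e_{j−1}^T (T_{j−1} − μ I)^{−1} e_{j−1}. Then α_j − α_j^{(μ)} > 0 for j = 1,…,k, and the recursion α_{j+1}^{(μ)} = μ + β_j²/(α_j − α_j^{(μ)}) holds for j = 1,…,k−1. -/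
open Matrix Finset

/-- The Schur complement of the last row and column, when that row and column vanish outside
the last two positions, in terms of the last diagonal entries of the inverses. -/
theorem Matrix.inv_last_mul_schur_eq_one {K : Type*} [Field K] {n : ℕ}
    (M : Matrix (Fin (n + 2)) (Fin (n + 2)) K) (N : Matrix (Fin (n + 1)) (Fin (n + 1)) K)
    (hN : M.submatrix Fin.castSucc Fin.castSucc = N) (hM : M.IsSymm)
    (hzero : ∀ i : Fin (n + 1), i ≠ Fin.last n → M i.castSucc (Fin.last (n + 1)) = 0)
    (hMdet : IsUnit M.det) (hNdet : IsUnit N.det) :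
    M⁻¹ (Fin.last (n + 1)) (Fin.last (n + 1)) *
      (M (Fin.last (n + 1)) (Fin.last (n + 1)) -
        M (Fin.last n).castSucc (Fin.last (n + 1)) ^ 2 * N⁻¹ (Fin.last n) (Fin.last n)) = 1 := by
  set l := Fin.last (n + 1)
  set b := M (Fin.last n).castSucc l with hb
  set y : Fin (n + 1) → K := fun i => M⁻¹ i.castSucc l
  have hcol (i : Fin (n + 2)) :
      ∑ m : Fin (n + 1), M i m.castSucc * y m + M i l * M⁻¹ l l = (1 : Matrix _ _ K) i l := by
    rw [← Matrix.mul_nonsing_inv M hMdet, Matrix.mul_apply]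
    exact (Fin.sum_univ_castSucc fun j => M i j * M⁻¹ j l).symm
  have hNy : N *ᵥ y = (-(b * M⁻¹ l l)) • Pi.single (Fin.last n) 1 := by
    ext i
    have h := hcol i.castSucc
    rw [Matrix.one_apply_ne (Fin.castSucc_lt_last i).ne] at h
    have hrow : (N *ᵥ y) i = ∑ m : Fin (n + 1), M i.castSucc m.castSucc * y m := by
      subst hN; rfl
    rw [hrow, eq_neg_of_add_eq_zero_left h]
    by_cases hi : i = Fin.last n
    · subst hi; simp [hb]
    · simp [hi, hzero i hi]
  have hyl : y (Fin.last n) = -(b * M⁻¹ l l) * N⁻¹ (Fin.last n) (Fin.last n) := by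
    have h : y = N⁻¹ *ᵥ (N *ᵥ y) := by
      rw [Matrix.mulVec_mulVec, Matrix.nonsing_inv_mul N hNdet, Matrix.one_mulVec]
    rw [hNy, Matrix.mulVec_smul] at h
    simpa using congrFun h (Fin.last n)
  have hlast := hcol l
  rw [Matrix.one_apply_eq, Finset.sum_eq_single (Fin.last n)] at hlast
  · rw [hyl, hM.apply] at hlast
    linear_combination hlast
  · intro m _ hm
    rw [hM.apply, hzero m hm, zero_mul]
  · simp

/-- for a Jacobi matrix `T` with leading principal submatrices `T_j` and
`μ` below the smallest eigenvalue of every `T_j` (expressed as positive definiteness of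
`T_j - μ I`), the modified coefficients `α_j^{(μ)}` (with `α_1^{(μ)} = μ` and
`α_{j+1}^{(μ)} = μ + β_j² eᵀ(T_j - μI)⁻¹e`) satisfy `α_j - α_j^{(μ)} > 0` and the
recursion `α_{j+1}^{(μ)} = μ + β_j²/(α_j - α_j^{(μ)})`. -/
theorem stmt10
    (k : ℕ) (μ : ℝ) (T : Matrix (Fin (k + 1)) (Fin (k + 1)) ℝ)
    (hsymm : T.IsSymm)
    (htri : ∀ i j : Fin (k + 1), (i : ℕ) + 1 < (j : ℕ) → T i j = 0)
    (hoff : ∀ i : Fin k, 0 < T i.castSucc i.succ)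
    (hμ : ∀ j : Fin (k + 1),
      ((T.submatrix (Fin.castLE j.isLt) (Fin.castLE j.isLt) :
          Matrix (Fin ((j : ℕ) + 1)) (Fin ((j : ℕ) + 1)) ℝ) - μ • 1).PosDef)
    (a : Fin (k + 1) → ℝ)
    (ha0 : a 0 = μ)
    (haS : ∀ j : Fin k, a j.succ = μ + (T j.castSucc j.succ) ^ 2 *
      (Pi.single (Fin.last (j : ℕ)) 1 ⬝ᵥ
        ((T.submatrix (Fin.castLE (Nat.succ_le_succ j.isLt.le))
            (Fin.castLE (Nat.succ_le_succ j.isLt.le)) :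
            Matrix (Fin ((j : ℕ) + 1)) (Fin ((j : ℕ) + 1)) ℝ) - μ • 1)⁻¹ *ᵥ
        Pi.single (Fin.last (j : ℕ)) 1)) :
    (∀ j : Fin (k + 1), 0 < T j j - a j) ∧
    (∀ j : Fin k, a j.succ
      = μ + (T j.castSucc j.succ) ^ 2 / (T j.castSucc j.castSucc - a j.castSucc)) := by
  have hunit (n : ℕ) (hn : n + 1 ≤ k + 1) :
      IsUnit ((T.submatrix (Fin.castLE hn) (Fin.castLE hn) :
        Matrix (Fin (n + 1)) (Fin (n + 1)) ℝ) - μ • 1).det :=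
    isUnit_iff_ne_zero.mpr (hμ ⟨n, hn⟩).det_pos.ne'
  have key (n : ℕ) (hn : n + 1 ≤ k + 1) :
      ((T.submatrix (Fin.castLE hn) (Fin.castLE hn) :
          Matrix (Fin (n + 1)) (Fin (n + 1)) ℝ) - μ • 1)⁻¹ (Fin.last n) (Fin.last n) *
        (T ⟨n, hn⟩ ⟨n, hn⟩ - a ⟨n, hn⟩) = 1 := by
    cases n with
    | zero =>
      have inv_mul (M : Matrix (Fin (0 + 1)) (Fin (0 + 1)) ℝ) (hM : IsUnit M.det) :
          M⁻¹ 0 0 * M 0 0 = 1 := by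
        simpa [Matrix.mul_apply] using congrFun (congrFun (Matrix.nonsing_inv_mul M hM) 0) 0
      have h := inv_mul _ (hunit 0 hn)
      rw [Matrix.sub_apply, Matrix.smul_apply, Matrix.one_apply_eq, smul_eq_mul, mul_one] at h
      rw [show (⟨0, hn⟩ : Fin (k + 1)) = 0 from rfl, ha0]
      exact h
    | succ n =>
      have hn' : n + 1 ≤ k + 1 := by omega
      have hcast : Fin.castLE hn (Fin.last (n + 1)) = ⟨n + 1, hn⟩ := rfl
      have hcast' : Fin.castLE hn (Fin.last n).castSucc = ⟨n, hn'⟩ := rfl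
      have h := Matrix.inv_last_mul_schur_eq_one
        ((T.submatrix (Fin.castLE hn) (Fin.castLE hn) :
          Matrix (Fin (n + 2)) (Fin (n + 2)) ℝ) - μ • 1)
        ((T.submatrix (Fin.castLE hn') (Fin.castLE hn') :
          Matrix (Fin (n + 1)) (Fin (n + 1)) ℝ) - μ • 1)
        (by
          ext p q
          simp [Matrix.one_apply])
        ((hsymm.submatrix _).sub (Matrix.isSymm_one.smul μ))
        (fun i hi => by
          have hlt : (i : ℕ) < n := Fin.val_lt_last hi
          rw [Matrix.sub_apply, Matrix.smul_apply,
            Matrix.one_apply_ne (Fin.castSucc_lt_last i).ne, smul_zero, sub_zero]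
          exact htri _ _ (by simpa using hlt))
        (hunit (n + 1) hn) (hunit n hn')
      have hne : (Fin.last n).castSucc ≠ Fin.last (n + 1) := (Fin.castSucc_lt_last _).ne
      rw [Matrix.sub_apply _ _ (Fin.last _) (Fin.last _), Matrix.sub_apply _ _ (Fin.castSucc _),
        Matrix.smul_apply, Matrix.smul_apply,
        Matrix.one_apply_eq, Matrix.one_apply_ne hne, Matrix.submatrix_apply,
        Matrix.submatrix_apply, hcast, hcast', smul_zero, sub_zero, smul_eq_mul, mul_one] at h
      have ha := haS ⟨n, Nat.lt_of_succ_lt_succ hn⟩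
      rw [Matrix.mulVec_single_one, single_one_dotProduct] at ha
      rw [show a ⟨n + 1, hn⟩ = _ from ha, ← sub_sub]
      exact h
  have pos (j : Fin (k + 1)) : 0 < T j j - a j :=
    pos_of_mul_pos_right (by rw [key j j.isLt]; exact one_pos) (hμ j).inv.diag_pos.le
  refine ⟨pos, fun j => ?_⟩
  rw [haS j, Matrix.mulVec_single_one, single_one_dotProduct, div_eq_mul_inv]
  congr 2
  exact eq_inv_of_mul_eq_one_left (key j (Nat.succ_le_succ j.isLt.le))
end

section
/- Let γ_0,…,γ_{k−1} and δ_1,…,δ_{k−1} be positive reals and let T_k = L_k D_k L_k^T be the Jacobi matrix built from them (L_k unit lower bidiagonal with subdiagonal √δ_1,…,√δ_{k−1}, D_k = diag(γ_0^{−1},…,γ_{k−1}^{−1})). Let T_k = S_k Θ_k S_k^T be a spectral decomposition with S_k orthogonal, eigenvalues θ_1^{(k)} < ⋯ < θ_k^{(k)}, and last-row entries s_{k,i}^{(k)} of S_k. Define φ_0 = 1 and φ_j^{−1} = 1 + φ_{j−1}^{−1} δ_j for j = 1,…,k−1. Then for every μ with 0 < μ < θ_1^{(k)}: e_k^T (T_k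 − μ I)^{−1} e_k = γ_{k−1} + μ γ_{k−1}²/φ_{k−1} + Σ_{i=1}^{k} (μ/θ_i^{(k)})² (s_{k,i}^{(k)})²/(θ_i^{(k)} − μ). -/
open Matrix Finset

/-- The solution `y` of `Lᵀ y = e` for a unit lower bidiagonal `L` with subdiagonal `√δ`,
together with its squared norm. -/
lemma exists_bidiagonal_solution (k : ℕ) (δ : Fin k → ℝ) (hδ : ∀ i, 0 < δ i)
    (φ : Fin (k + 1) → ℝ) (hφ0 : φ 0 = 1)
    (hφ : ∀ j : Fin k, (φ j.succ)⁻¹ = 1 + (φ j.castSucc)⁻¹ * δ j) :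
    ∃ y : Fin (k + 1) → ℝ, y (Fin.last k) = 1 ∧
      (∀ i : Fin k, y i.castSucc + √(δ i) * y i.succ = 0) ∧
      ∑ i, y i ^ 2 = (φ (Fin.last k))⁻¹ := by
  induction k with
  | zero => exact ⟨fun _ => 1, rfl, fun i => i.elim0, by simp [hφ0]⟩
  | succ k ih =>
    obtain ⟨y, hlast, hrec, hsum⟩ := ih (fun i => δ i.castSucc) (fun i => hδ _)
      (fun i => φ i.castSucc) (by simpa using hφ0) (fun j => by simpa using hφ j.castSucc)
    refine ⟨Fin.snoc (α := fun _ => ℝ) (fun i => -√(δ (Fin.last k)) * y i) 1, by simp, ?_, ?_⟩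
    · intro i
      induction i using Fin.lastCases with
      | last => simp [hlast]
      | cast j =>
        rw [← Fin.castSucc_succ]
        simp only [Fin.snoc_castSucc]
        linear_combination (-√(δ (Fin.last k))) * hrec j
    · rw [Fin.sum_univ_castSucc]
      simp only [Fin.snoc_castSucc, Fin.snoc_last, mul_pow, neg_sq, ← Finset.mul_sum, hsum]
      rw [Real.sq_sqrt (hδ _).le, ← Fin.succ_last, hφ]
      ring

lemma transpose_bidiagonal_mulVec (k : ℕ) (L : Matrix (Fin (k + 1)) (Fin (k + 1)) ℝ)
    (d : Fin k → ℝ) (hLdiag : ∀ i, L i i = 1) (hLsub : ∀ i : Fin k, L i.succ i.castSucc = d i)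
    (hLzero : ∀ i j : Fin (k + 1), (i : ℕ) ≠ (j : ℕ) → (i : ℕ) ≠ (j : ℕ) + 1 → L i j = 0)
    (y : Fin (k + 1) → ℝ) (hlast : y (Fin.last k) = 1)
    (hrec : ∀ i : Fin k, y i.castSucc + d i * y i.succ = 0) :
    Lᵀ *ᵥ y = Pi.single (Fin.last k) 1 := by
  ext i
  simp only [mulVec, dotProduct, transpose_apply]
  induction i using Fin.lastCases with
  | last =>
    rw [Finset.sum_eq_single (Fin.last k)]
    · simp [hLdiag, hlast]
    · intro j _ hj
      rw [hLzero j _ (fun h => hj (Fin.ext h)) (by simp; omega), zero_mul]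
    · simp
  | cast i =>
    rw [Finset.sum_eq_add i.castSucc i.succ (Fin.castSucc_lt_succ).ne]
    · rw [hLdiag, hLsub, one_mul, hrec, Pi.single_eq_of_ne (Fin.castSucc_lt_last i).ne]
    · intro j _ hj
      rw [hLzero j _ (fun h => hj.1 (Fin.ext h)) (fun h => hj.2 (Fin.ext (by simpa using h))),
        zero_mul]
    · simp
    · simp

lemma bidiagonal_mulVec_single_last (k : ℕ) (L : Matrix (Fin (k + 1)) (Fin (k + 1)) ℝ)
    (hLdiag : ∀ i, L i i = 1)
    (hLzero : ∀ i j : Fin (k + 1), (i : ℕ) ≠ (j : ℕ) → (i : ℕ) ≠ (j : ℕ) + 1 → L i j = 0) :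
    L *ᵥ Pi.single (Fin.last k) 1 = Pi.single (Fin.last k) 1 := by
  ext i
  rw [mulVec_single_one, col_apply]
  by_cases hi : i = Fin.last k
  · simp [hi, hLdiag]
  · rw [hLzero i _ (fun h => hi (Fin.ext h)) (by simp; omega), Pi.single_eq_of_ne hi]

/-- for the CG Jacobi matrix `T = L D Lᵀ` with spectral decomposition
`T = S Θ Sᵀ` and `0 < μ < θ 0`,
`eᵀ(T - μI)⁻¹e = γ_{k-1} + μ γ_{k-1}²/φ_{k-1} + ∑ᵢ (μ/θᵢ)² s_{k,i}²/(θᵢ - μ)`. -/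
theorem stmt12
    (k : ℕ) (γ : Fin (k + 1) → ℝ) (δ : Fin k → ℝ)
    (hγ : ∀ i, 0 < γ i) (hδ : ∀ i, 0 < δ i)
    (L T S : Matrix (Fin (k + 1)) (Fin (k + 1)) ℝ)
    (θ φ : Fin (k + 1) → ℝ) (μ : ℝ)
    (hLdiag : ∀ i, L i i = 1)
    (hLsub : ∀ i : Fin k, L i.succ i.castSucc = Real.sqrt (δ i))
    (hLzero : ∀ i j : Fin (k + 1), (i : ℕ) ≠ (j : ℕ) → (i : ℕ) ≠ (j : ℕ) + 1 → L i j = 0)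
    (hT : T = L * Matrix.diagonal (fun i => (γ i)⁻¹) * Lᵀ)
    (hθ : StrictMono θ) (hS : S * Sᵀ = 1) (hspec : T = S * Matrix.diagonal θ * Sᵀ)
    (hφ0 : φ 0 = 1)
    (hφ : ∀ j : Fin k, (φ j.succ)⁻¹ = 1 + (φ j.castSucc)⁻¹ * δ j)
    (hμ0 : 0 < μ) (hμ : μ < θ 0) :
    Pi.single (Fin.last k) 1 ⬝ᵥ (T - μ • 1)⁻¹ *ᵥ Pi.single (Fin.last k) 1
      = γ (Fin.last k) + μ * (γ (Fin.last k)) ^ 2 / φ (Fin.last k)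
        + ∑ i, (μ / θ i) ^ 2 * (S (Fin.last k) i) ^ 2 / (θ i - μ) := by
  obtain ⟨y, hlast, hrec, hsum⟩ := exists_bidiagonal_solution k δ hδ φ hφ0 hφ
  set e : Fin (k + 1) → ℝ := Pi.single (Fin.last k) 1 with he
  have hLy : Lᵀ *ᵥ y = e := transpose_bidiagonal_mulVec k L _ hLdiag hLsub hLzero y hlast hrec
  have hLe : L *ᵥ e = e := bidiagonal_mulVec_single_last k L hLdiag hLzero
  set g := γ (Fin.last k) with hg
  have hg0 : g ≠ 0 := (hγ _).ne'
  have hS' : Sᵀ * S = 1 := mul_eq_one_comm.mp hS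
  have hpos : ∀ i, μ < θ i := fun i => hμ.trans_le (hθ.monotone (Fin.zero_le i))
  have hDe : diagonal (fun i => (γ i)⁻¹) *ᵥ e = g⁻¹ • e := by
    ext i
    by_cases hi : i = Fin.last k
    · simp [mulVec_diagonal, he, hi, hg]
    · simp [mulVec_diagonal, he, hi]
  have hTy : T *ᵥ y = g⁻¹ • e := by
    rw [hT, ← mulVec_mulVec, ← mulVec_mulVec, hLy, hDe, mulVec_smul, hLe]
  have hSe : Sᵀ *ᵥ e = fun i => S (Fin.last k) i := by
    ext i
    simp [he]
  set z := Sᵀ *ᵥ y with hz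
  have hSz : S *ᵥ z = y := by rw [hz, mulVec_mulVec, hS, one_mulVec]
  have hθz : ∀ i, θ i * z i = g⁻¹ * S (Fin.last k) i := by
    have h : diagonal θ *ᵥ z = g⁻¹ • (Sᵀ *ᵥ e) := by
      rw [← mulVec_smul, ← hTy, hspec, ← mulVec_mulVec, ← mulVec_mulVec,
        mulVec_mulVec _ Sᵀ S, hS', one_mulVec]
    intro i
    simpa [mulVec_diagonal, hSe] using congrFun h i
  have hzi : ∀ i, z i = g⁻¹ * S (Fin.last k) i / θ i := fun i => by
    rw [eq_div_iff (hμ0.trans (hpos i)).ne', mul_comm, hθz]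
  have hfirst : ∑ i, S (Fin.last k) i ^ 2 / θ i = g := by
    have h : ∑ i, S (Fin.last k) i * z i = 1 := by
      rw [← hlast, ← hSz]
      rfl
    calc ∑ i, S (Fin.last k) i ^ 2 / θ i = g * ∑ i, S (Fin.last k) i * z i := by
          rw [Finset.mul_sum]
          refine Finset.sum_congr rfl fun i _ => ?_
          rw [hzi]
          field_simp
      _ = g := by rw [h, mul_one]
  have hsecond : ∑ i, S (Fin.last k) i ^ 2 / θ i ^ 2 = g ^ 2 / φ (Fin.last k) := by
    have h : ∑ i, z i ^ 2 = (φ (Fin.last k))⁻¹ := by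
      have hzz : z ⬝ᵥ z = y ⬝ᵥ y := by
        conv_rhs => rw [← hSz, dotProduct_mulVec, ← mulVec_transpose, mulVec_mulVec, hS',
          one_mulVec]
      simpa only [← hsum, dotProduct, ← sq] using hzz
    rw [div_eq_mul_inv (g ^ 2), ← h, Finset.mul_sum]
    refine Finset.sum_congr rfl fun i _ => ?_
    rw [hzi]
    field_simp
  have hinv : (T - μ • 1)⁻¹ = S * diagonal (fun i => (θ i - μ)⁻¹) * Sᵀ := by
    apply inv_eq_right_inv
    have hshift : T - μ • 1 = S * diagonal (fun i => θ i - μ) * Sᵀ := by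
      rw [← diagonal_sub, Matrix.mul_sub, Matrix.sub_mul, ← hspec, ← smul_one_eq_diagonal,
        Matrix.mul_smul, Matrix.smul_mul, Matrix.mul_one, hS]
    rw [hshift]
    calc S * diagonal (fun i => θ i - μ) * Sᵀ * (S * diagonal (fun i => (θ i - μ)⁻¹) * Sᵀ)
        = S * (diagonal (fun i => θ i - μ) * (Sᵀ * S) * diagonal (fun i => (θ i - μ)⁻¹)) * Sᵀ := by
          simp only [Matrix.mul_assoc]
      _ = 1 := by
          rw [hS', Matrix.mul_one, diagonal_mul_diagonal]
          simp [fun i => mul_inv_cancel₀ (sub_pos.mpr (hpos i)).ne', hS]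
  have hquad : e ⬝ᵥ (T - μ • 1)⁻¹ *ᵥ e = ∑ i, S (Fin.last k) i ^ 2 / (θ i - μ) := by
    rw [hinv, ← mulVec_mulVec, ← mulVec_mulVec, dotProduct_mulVec, ← mulVec_transpose, hSe]
    simp only [dotProduct, mulVec_diagonal]
    exact Finset.sum_congr rfl fun i _ => by ring
  rw [hquad, mul_div_assoc, ← hsecond, ← hfirst, Finset.mul_sum, ← Finset.sum_add_distrib,
    ← Finset.sum_add_distrib]
  refine Finset.sum_congr rfl fun i _ => ?_
  have h1 : θ i ≠ 0 := (hμ0.trans (hpos i)).ne'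
  have h2 : θ i - μ ≠ 0 := (sub_pos.mpr (hpos i)).ne'
  field_simp
  ring
end

section
/- Under the hypotheses of the preceding setting (T_k = L_k D_k L_k^T a Jacobi matrix built from positive γ_0,…,γ_{k−1} and δ_1,…,δ_{k−1}; β_k = √δ_k/γ_{k−1} with δ_k > 0; 0 < μ < θ_1^{(k)}; φ_0 = 1, φ_j^{−1} = 1 + φ_{j−1}^{−1} δ_j for j ≤ k; γ_k^{(μ)} = (α_{k+1}^{(μ)} − δ_k/γ_{k−1})^{−1} with α_{k+1}^{(μ)} = μ + β_k² e_k^T(T_k − μI)^{−1}e_k), one has 0 < γ_k^{(μ)} < φ_k/μ. -/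
open Matrix Finset

/-- The solution of `Lᵀ x = e` for a unit lower bidiagonal `L` with subdiagonal `a`,
where `e` is the last standard basis vector. -/
noncomputable def backSubst {k : ℕ} (a : Fin k → ℝ) : Fin (k + 1) → ℝ :=
  Fin.reverseInduction (motive := fun _ => ℝ) 1 (fun i y => -a i * y)

lemma backSubst_last {k : ℕ} (a : Fin k → ℝ) : backSubst a (Fin.last k) = 1 := by
  simp [backSubst]

lemma backSubst_castSucc {k : ℕ} (a : Fin k → ℝ) (i : Fin k) :
    backSubst a i.castSucc = -a i * backSubst a i.succ := by
  simp [backSubst]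

lemma transpose_mulVec_backSubst {k : ℕ} (L : Matrix (Fin (k + 1)) (Fin (k + 1)) ℝ)
    (a : Fin k → ℝ) (hLdiag : ∀ i, L i i = 1) (hLsub : ∀ i : Fin k, L i.succ i.castSucc = a i)
    (hLzero : ∀ i j : Fin (k + 1), (i : ℕ) ≠ (j : ℕ) → (i : ℕ) ≠ (j : ℕ) + 1 → L i j = 0) :
    Lᵀ *ᵥ backSubst a = Pi.single (Fin.last k) 1 := by
  ext j
  simp only [mulVec, dotProduct, transpose_apply]
  induction j using Fin.lastCases with
  | last =>
    rw [Finset.sum_eq_single (Fin.last k)]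
    · simp [hLdiag, backSubst_last]
    · intro i _ hi
      have hne : (i : ℕ) ≠ k := fun h => hi (Fin.ext h)
      rw [hLzero i _ (by simpa using hne) (by have := i.2; simp only [Fin.val_last]; omega),
        zero_mul]
    · simp
  | cast j =>
    have hne : j.castSucc ≠ j.succ := by simp [Fin.ext_iff]
    rw [← Finset.sum_subset (Finset.subset_univ {j.castSucc, j.succ}), Finset.sum_pair hne,
      hLdiag, hLsub, backSubst_castSucc, Pi.single_eq_of_ne (by simp [Fin.ext_iff, j.2.ne])]
    · ring
    · intro i _ hi
      simp only [Finset.mem_insert, Finset.mem_singleton, not_or, Fin.ext_iff,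
        Fin.val_castSucc, Fin.val_succ] at hi
      rw [hLzero i _ (by simpa using hi.1) (by simpa using hi.2), zero_mul]

lemma sum_Iic_backSubst_sq {k : ℕ} (δ : Fin k → ℝ) (hδ : ∀ i, 0 ≤ δ i) (ψ : Fin (k + 1) → ℝ)
    (hψ0 : ψ 0 = 1) (hψ : ∀ j : Fin k, ψ j.succ = 1 + ψ j.castSucc * δ j) (j : Fin (k + 1)) :
    ∑ i ∈ Iic j, backSubst (fun i => √(δ i)) i ^ 2 =
      backSubst (fun i => √(δ i)) j ^ 2 * ψ j := by
  induction j using Fin.induction with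
  | zero =>
    have h : (Iic 0 : Finset (Fin (k + 1))) = {0} := by ext; simp
    rw [h, Finset.sum_singleton, hψ0, mul_one]
  | succ j ih =>
    have h : (Iic j.succ : Finset (Fin (k + 1))) = insert j.succ (Iic j.castSucc) := by
      ext i
      simp only [Finset.mem_Iic, Finset.mem_insert, Fin.ext_iff, Fin.le_def, Fin.val_castSucc,
        Fin.val_succ]
      omega
    rw [h, Finset.sum_insert (by simp [Fin.le_def]), ih, hψ, backSubst_castSucc, mul_pow, neg_sq,
      Real.sq_sqrt (hδ j)]
    ring

lemma mulVec_single_last {k : ℕ} (L : Matrix (Fin (k + 1)) (Fin (k + 1)) ℝ)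
    (hLdiag : ∀ i, L i i = 1)
    (hLzero : ∀ i j : Fin (k + 1), (i : ℕ) ≠ (j : ℕ) → (i : ℕ) ≠ (j : ℕ) + 1 → L i j = 0) :
    L *ᵥ Pi.single (Fin.last k) 1 = Pi.single (Fin.last k) 1 := by
  ext i
  rw [mulVec_single_one, col_apply]
  by_cases hi : i = Fin.last k
  · simp [hi, hLdiag]
  · have hne : (i : ℕ) ≠ k := fun h => hi (Fin.ext h)
    rw [Pi.single_eq_of_ne hi]
    exact hLzero i _ (by simpa using hne) (by have := i.2; simp only [Fin.val_last]; omega)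

/-- For `T` symmetric with spectrum above `μ > 0` and `w ≠ 0`, the vector `e = T w` satisfies
`eᵀ T⁻¹ e + μ ‖T⁻¹ e‖² < eᵀ (T - μ)⁻¹ e`. -/
lemma dotProduct_add_lt_resolvent {n : Type*} [Fintype n] [DecidableEq n] (S T : Matrix n n ℝ)
    (θ : n → ℝ) (hS : S * Sᵀ = 1) (hspec : T = S * diagonal θ * Sᵀ) {μ : ℝ} (hμ0 : 0 < μ)
    (hμ : ∀ i, μ < θ i) (w : n → ℝ) (hw : w ≠ 0) :
    w ⬝ᵥ (T *ᵥ w) + μ * (w ⬝ᵥ w) < (T *ᵥ w) ⬝ᵥ ((T - μ • 1)⁻¹ *ᵥ (T *ᵥ w)) := by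
  have hS' : Sᵀ * S = 1 := mul_eq_one_comm.mp hS
  have hshift : T - μ • 1 = S * diagonal (fun i => θ i - μ) * Sᵀ := by
    have : diagonal (fun i => θ i - μ) = diagonal θ - μ • (1 : Matrix n n ℝ) := by
      rw [smul_one_eq_diagonal, diagonal_sub]
    rw [this, mul_sub, sub_mul, ← hspec, mul_smul_comm, mul_one, smul_mul_assoc, hS]
  have hinv : (T - μ • 1)⁻¹ = S * diagonal (fun i => (θ i - μ)⁻¹) * Sᵀ := by
    apply inv_eq_right_inv
    have hd : diagonal (fun i => θ i - μ) * diagonal (fun i => (θ i - μ)⁻¹)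
        = (1 : Matrix n n ℝ) := by
      rw [diagonal_mul_diagonal, ← diagonal_one]
      congr 1
      ext i
      exact mul_inv_cancel₀ (sub_pos.mpr (hμ i)).ne'
    calc _ = S * diagonal (fun i => θ i - μ) * (Sᵀ * S) * diagonal (fun i => (θ i - μ)⁻¹) * Sᵀ := by
          rw [hshift]; simp only [mul_assoc]
      _ = S * (diagonal (fun i => θ i - μ) * diagonal (fun i => (θ i - μ)⁻¹)) * Sᵀ := by
          rw [hS', mul_one]; simp only [mul_assoc]
      _ = 1 := by rw [hd, mul_one, hS]
  obtain ⟨u, rfl⟩ : ∃ u, w = S *ᵥ u := ⟨Sᵀ *ᵥ w, by rw [mulVec_mulVec, hS, one_mulVec]⟩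
  have hdot (a b : n → ℝ) : (S *ᵥ a) ⬝ᵥ (S *ᵥ b) = a ⬝ᵥ b := by
    rw [dotProduct_mulVec, ← mulVec_transpose, mulVec_mulVec, hS', one_mulVec]
  have hcancel (d a : n → ℝ) :
      (S * diagonal d * Sᵀ) *ᵥ (S *ᵥ a) = S *ᵥ (diagonal d *ᵥ a) := by
    rw [mulVec_mulVec, mul_assoc, mul_assoc, hS', mul_one, ← mulVec_mulVec]
  have hu : ∃ i, u i ≠ 0 := by
    by_contra! h
    exact hw (by rw [show u = 0 from funext h, mulVec_zero])
  obtain ⟨i₀, hi₀⟩ := hu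
  rw [hinv, hspec, hcancel, hcancel, hdot, hdot, hdot]
  simp only [dotProduct, mulVec_diagonal, Finset.mul_sum, ← Finset.sum_add_distrib]
  have key (i : n) : θ i * u i * ((θ i - μ)⁻¹ * (θ i * u i))
      - (u i * (θ i * u i) + μ * (u i * u i)) = μ ^ 2 * (θ i - μ)⁻¹ * u i ^ 2 := by
    have := (sub_pos.mpr (hμ i)).ne'
    field_simp
    ring
  have hpos (i : n) : 0 < (θ i - μ)⁻¹ := inv_pos.mpr (sub_pos.mpr (hμ i))
  apply Finset.sum_lt_sum
  · intro i _
    have := hpos i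
    rw [← sub_nonneg, key]
    positivity
  · refine ⟨i₀, Finset.mem_univ _, ?_⟩
    have := hpos i₀
    rw [← sub_pos, key]
    positivity

/-- under the Gauss–Radau setting, `0 < γ_k^{(μ)} < φ_k/μ`. -/
theorem stmt15
    (k : ℕ) (γ : Fin (k + 1) → ℝ) (δ : Fin k → ℝ) (δk μ : ℝ)
    (hγ : ∀ i, 0 < γ i) (hδ : ∀ i, 0 < δ i) (hδk : 0 < δk)
    (L T S : Matrix (Fin (k + 1)) (Fin (k + 1)) ℝ)
    (θ : Fin (k + 1) → ℝ) (φ : Fin (k + 2) → ℝ)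
    (hLdiag : ∀ i, L i i = 1)
    (hLsub : ∀ i : Fin k, L i.succ i.castSucc = Real.sqrt (δ i))
    (hLzero : ∀ i j : Fin (k + 1), (i : ℕ) ≠ (j : ℕ) → (i : ℕ) ≠ (j : ℕ) + 1 → L i j = 0)
    (hT : T = L * Matrix.diagonal (fun i => (γ i)⁻¹) * Lᵀ)
    (hθ : StrictMono θ) (hS : S * Sᵀ = 1) (hspec : T = S * Matrix.diagonal θ * Sᵀ)
    (β : ℝ) (hβ : β = Real.sqrt δk / γ (Fin.last k))
    (hφ0 : φ 0 = 1)
    (hφ : ∀ j : Fin (k + 1), (φ j.succ)⁻¹ = 1 + (φ j.castSucc)⁻¹ *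
      (Fin.snoc (fun i : Fin k => δ i) δk : Fin (k + 1) → ℝ) j)
    (hμ0 : 0 < μ) (hμ : μ < θ 0)
    (αμ : ℝ)
    (hαμ : αμ = μ + β ^ 2 *
      (Pi.single (Fin.last k) 1 ⬝ᵥ (T - μ • 1)⁻¹ *ᵥ Pi.single (Fin.last k) 1))
    (γμ : ℝ) (hγμ : γμ = (αμ - δk / γ (Fin.last k))⁻¹) :
    0 < γμ ∧ γμ < φ (Fin.last (k + 1)) / μ := by
  set e : Fin (k + 1) → ℝ := Pi.single (Fin.last k) 1 with he
  set x := backSubst (fun i => √(δ i)) with hx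
  set g := γ (Fin.last k) with hg
  have hg0 : 0 < g := hγ _
  set ψ : Fin (k + 1) → ℝ := fun j => (φ j.castSucc)⁻¹ with hψdef
  have hψ0 : ψ 0 = 1 := by simp [hψdef, hφ0]
  have hψ (j : Fin k) : ψ j.succ = 1 + ψ j.castSucc * δ j := by
    have := hφ j.castSucc
    rwa [Fin.snoc_castSucc, Fin.succ_castSucc] at this
  have hxx : x ⬝ᵥ x = ψ (Fin.last k) := by
    have h := sum_Iic_backSubst_sq δ (fun i => (hδ i).le) ψ hψ0 hψ (Fin.last k)
    have huniv : (Iic (Fin.last k) : Finset (Fin (k + 1))) = univ := by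
      ext i; simp [Fin.le_last]
    rw [huniv, backSubst_last, one_pow, one_mul] at h
    simpa only [dotProduct, ← sq] using h
  have hTw : T *ᵥ (g • x) = e := by
    have hD : diagonal (fun i => (γ i)⁻¹) *ᵥ e = g⁻¹ • e := by
      ext i
      by_cases hi : i = Fin.last k
      · simp [mulVec_diagonal, hi, hg]
      · simp [mulVec_diagonal, he, hi]
    rw [hT, mulVec_smul, ← mulVec_mulVec,
      transpose_mulVec_backSubst L _ hLdiag hLsub hLzero, ← mulVec_mulVec, hD, mulVec_smul,
      mulVec_single_last L hLdiag hLzero, smul_smul, mul_inv_cancel₀ hg0.ne', one_smul]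
  have hw : g • x ≠ 0 := by
    intro h
    have := congrFun h (Fin.last k)
    simp [hx, backSubst_last, hg0.ne'] at this
  have hmain := dotProduct_add_lt_resolvent S T θ hS hspec hμ0
    (fun i => hμ.trans_le (hθ.monotone (Fin.zero_le i))) (g • x) hw
  have hwe : (g • x) ⬝ᵥ e = g := by
    simp [he, hx, backSubst_last]
  have hww : (g • x) ⬝ᵥ (g • x) = g ^ 2 * ψ (Fin.last k) := by
    rw [smul_dotProduct, dotProduct_smul, hxx, smul_eq_mul, smul_eq_mul]
    ring
  rw [hTw, hwe, hww] at hmain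
  have hβ2 : β ^ 2 = δk / g ^ 2 := by
    rw [hβ, div_pow, Real.sq_sqrt hδk.le]
  have hφlast : (φ (Fin.last (k + 1)))⁻¹ = 1 + ψ (Fin.last k) * δk := by
    have := hφ (Fin.last k)
    rwa [Fin.snoc_last, Fin.succ_last] at this
  have hψpos : 0 ≤ ψ (Fin.last k) := by
    rw [← hxx]
    exact Finset.sum_nonneg fun i _ => mul_self_nonneg _
  have hlower : μ * (φ (Fin.last (k + 1)))⁻¹ < αμ - δk / g := by
    have h := mul_lt_mul_of_pos_left hmain (show 0 < δk / g ^ 2 by positivity)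
    have h' : δk / g ^ 2 * (g + μ * (g ^ 2 * ψ (Fin.last k))) =
        δk / g + μ * (ψ (Fin.last k) * δk) := by
      field_simp
    rw [h'] at h
    rw [hφlast, hαμ, hβ2]
    linarith
  have hinvpos : 0 < (φ (Fin.last (k + 1)))⁻¹ := by
    rw [hφlast]
    positivity
  have hprod : 0 < μ * (φ (Fin.last (k + 1)))⁻¹ := mul_pos hμ0 hinvpos
  rw [hγμ]
  refine ⟨inv_pos.mpr (hprod.trans hlower), ?_⟩
  have h := inv_strictAnti₀ hprod hlower
  rwa [mul_inv, inv_inv, mul_comm, ← div_eq_mul_inv] at h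
end

section
/- Let T_{k+1} be the (k+1)×(k+1) Jacobi matrix whose leading k×k principal submatrix is T_k, whose (k+1,k) and (k,k+1) entries equal β_k > 0, and whose (k+1,k+1) entry is α_{k+1}; let θ_1^{(k+1)} be the smallest eigenvalue of T_{k+1}, and let λ_1 be a real number with λ_1 < θ_1^{(k+1)}. Then α_{k+1} − α_{k+1}^{(λ_1)} = η_{1,k}^{(λ_1)} (θ_1^{(k+1)} − λ_1)/(θ_1^{(k)} − θ_1^{(k+1)}) + (θ_1^{(k+1)} − λ_1) E_k^{(θ_1^{(k+1)}, λ_1)}, where E_k^{(λ,μ)} = 1 + Σ_{i=2}^{k} η_{i,k}^{(λ)}/(θ_i^{(k)} − μ). -/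
open Matrix Finset

/-- An eigenvector of a tridiagonal matrix with nonvanishing subdiagonal which vanishes in the last
coordinate is zero. -/
lemma eq_zero_of_tridiagonal_mulVec_of_last {k : ℕ} {T : Matrix (Fin (k + 1)) (Fin (k + 1)) ℝ}
    (htri : ∀ i j : Fin (k + 1), (i : ℕ) + 1 < (j : ℕ) ∨ (j : ℕ) + 1 < (i : ℕ) → T i j = 0)
    (hoff : ∀ i : Fin k, T i.succ i.castSucc ≠ 0) {q : Fin (k + 1) → ℝ} {μ : ℝ}
    (hq : T *ᵥ q = μ • q) (hlast : q (Fin.last k) = 0) : q = 0 := by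
  have key : ∀ i : Fin (k + 1), ∀ j, i ≤ j → q j = 0 := by
    intro i
    induction i using Fin.reverseInduction with
    | last =>
      intro j hj
      rwa [Fin.last_le_iff.mp hj]
    | cast i ih =>
      intro j hj
      rcases hj.eq_or_lt with rfl | hj
      · have h := congrFun hq i.succ
        rw [Pi.smul_apply, ih i.succ le_rfl, smul_zero, mulVec, dotProduct,
          Finset.sum_eq_single i.castSucc] at h
        · exact (mul_eq_zero.mp h).resolve_left (hoff i)
        · intro j _ hj
          rcases lt_or_ge j i.succ with hlt | hge
          · rw [htri, zero_mul]
            right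
            have h1 : (j : ℕ) ≠ i := fun h => hj (Fin.ext h)
            have h2 : (j : ℕ) < i + 1 := hlt
            simp only [Fin.val_succ]
            omega
          · rw [ih j hge, mul_zero]
        · simp
      · exact ih j (Fin.castSucc_lt_iff_succ_le.mp hj)
  funext j
  exact key 0 j (Fin.zero_le j)

section SpectralDecomposition

variable {n : Type*} [Fintype n] [DecidableEq n] {A S : Matrix n n ℝ} {θ : n → ℝ}

lemma transpose_mulVec_mulVec_of_spectral (hS : S * Sᵀ = 1) (hA : A = S * diagonal θ * Sᵀ)
    (x : n → ℝ) (i : n) : (Sᵀ *ᵥ (A *ᵥ x)) i = θ i * (Sᵀ *ᵥ x) i := by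
  have h : Sᵀ * A = diagonal θ * Sᵀ := by
    rw [hA, ← Matrix.mul_assoc, ← Matrix.mul_assoc, mul_eq_one_comm.mp hS, Matrix.one_mul]
  rw [mulVec_mulVec, h, ← mulVec_mulVec, mulVec_diagonal]

lemma mulVec_col_of_spectral (hS : S * Sᵀ = 1) (hA : A = S * diagonal θ * Sᵀ) (i : n) :
    A *ᵥ S.col i = θ i • S.col i := by
  have h : A * S = S * diagonal θ := by
    rw [hA, Matrix.mul_assoc, mul_eq_one_comm.mp hS, Matrix.mul_one]
  ext a
  have := congrFun (congrFun h a) i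
  rw [mul_diagonal, mul_comm] at this
  exact this

lemma col_dotProduct_col_self (hS : S * Sᵀ = 1) (i : n) : S.col i ⬝ᵥ S.col i = 1 := by
  have h : (Sᵀ * S) i i = 1 := by rw [mul_eq_one_comm.mp hS, one_apply_eq]
  exact h

lemma transpose_mulVec_dotProduct (hS : S * Sᵀ = 1) (x y : n → ℝ) :
    (Sᵀ *ᵥ x) ⬝ᵥ (Sᵀ *ᵥ y) = x ⬝ᵥ y := by
  rw [dotProduct_mulVec, vecMul_transpose, mulVec_mulVec, hS, one_mulVec]

lemma eq_zero_of_transpose_mulVec_eq_zero (hS : S * Sᵀ = 1) {x : n → ℝ}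
    (h : Sᵀ *ᵥ x = 0) : x = 0 := by
  rw [← one_mulVec x, ← hS, ← mulVec_mulVec, h, mulVec_zero]

/-- The smallest eigenvalue is strictly below the Rayleigh quotient of any vector which is not an
eigenvector for it. -/
lemma dotProduct_mulVec_of_spectral_lt (hS : S * Sᵀ = 1) (hA : A = S * diagonal θ * Sᵀ) {m : ℝ}
    (hm : ∀ i, m ≤ θ i) {x : n → ℝ} (hx : A *ᵥ x ≠ m • x) :
    m * (x ⬝ᵥ x) < x ⬝ᵥ (A *ᵥ x) := by
  rw [← transpose_mulVec_dotProduct hS x x, ← transpose_mulVec_dotProduct hS x (A *ᵥ x)]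
  simp only [dotProduct, transpose_mulVec_mulVec_of_spectral hS hA, Finset.mul_sum]
  have hle : ∀ i ∈ univ, m * ((Sᵀ *ᵥ x) i * (Sᵀ *ᵥ x) i)
      ≤ (Sᵀ *ᵥ x) i * (θ i * (Sᵀ *ᵥ x) i) := fun i _ => by
    nlinarith [mul_nonneg (sub_nonneg.mpr (hm i)) (mul_self_nonneg ((Sᵀ *ᵥ x) i))]
  refine (Finset.sum_le_sum hle).lt_of_ne fun heq => hx ?_
  rw [Finset.sum_eq_sum_iff_of_le hle] at heq
  rw [← sub_eq_zero]
  refine eq_zero_of_transpose_mulVec_eq_zero hS ?_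
  ext i
  rw [mulVec_sub, mulVec_smul, Pi.sub_apply, transpose_mulVec_mulVec_of_spectral hS hA,
    Pi.smul_apply, smul_eq_mul, Pi.zero_apply, ← sub_mul]
  have h : (θ i - m) * ((Sᵀ *ᵥ x) i * (Sᵀ *ᵥ x) i) = 0 := by linarith [heq i (mem_univ i)]
  simpa using h

/-- Diagonal entries of the resolvent. -/
lemma single_dotProduct_resolvent_of_spectral (hS : S * Sᵀ = 1) (hA : A = S * diagonal θ * Sᵀ)
    {ν : ℝ} (hν : ∀ i, θ i - ν ≠ 0) (l : n) :
    Pi.single l 1 ⬝ᵥ (A - ν • 1)⁻¹ *ᵥ Pi.single l 1 = ∑ i, S l i ^ 2 / (θ i - ν) := by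
  have hS' := mul_eq_one_comm.mp hS
  have h : A - ν • 1 = S * diagonal (fun i => θ i - ν) * Sᵀ := by
    have : diagonal (fun i => θ i - ν) = diagonal θ - ν • (1 : Matrix n n ℝ) := by
      rw [← diagonal_one, ← diagonal_smul, diagonal_sub]
      simp
    rw [this, mul_sub, sub_mul, ← hA, Matrix.mul_smul, Matrix.smul_mul, Matrix.mul_one, hS]
  have hinv : (A - ν • 1)⁻¹ = S * diagonal (fun i => (θ i - ν)⁻¹) * Sᵀ := by
    refine inv_eq_right_inv ?_
    rw [h]
    calc _ = S * diagonal (fun i => θ i - ν) * (Sᵀ * S) * diagonal (fun i => (θ i - ν)⁻¹) * Sᵀ := by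
          simp only [Matrix.mul_assoc]
      _ = 1 := by
          rw [hS', Matrix.mul_one, Matrix.mul_assoc S, diagonal_mul_diagonal]
          simp [hν, hS]
  rw [hinv, mulVec_single_one, single_one_dotProduct, col_apply, Matrix.mul_apply]
  refine Finset.sum_congr rfl fun i _ => ?_
  rw [mul_diagonal, transpose_apply]
  ring

end SpectralDecomposition

/-- with `θ' 0` the smallest eigenvalue of the extended Jacobi matrix
`T'` (bottom corner `αk1`) and `λ₁ < θ' 0`,
`αk1 - α_{k+1}^{(λ₁)} = η_{1,k}^{(λ₁)} (θ'₁ - λ₁)/(θ₁ - θ'₁) + (θ'₁ - λ₁) E_k^{(θ'₁,λ₁)}`. -/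
theorem stmt19
    (k : ℕ) (T S : Matrix (Fin (k + 1)) (Fin (k + 1)) ℝ)
    (T' S' : Matrix (Fin (k + 2)) (Fin (k + 2)) ℝ)
    (θ : Fin (k + 1) → ℝ) (θ' : Fin (k + 2) → ℝ) (β αk1 lam1 : ℝ)
    (hsymm : T.IsSymm)
    (htri : ∀ i j : Fin (k + 1), (i : ℕ) + 1 < (j : ℕ) → T i j = 0)
    (hoff : ∀ i : Fin k, 0 < T i.castSucc i.succ)
    (hθ : StrictMono θ)
    (hS : S * Sᵀ = 1)
    (hspec : T = S * Matrix.diagonal θ * Sᵀ)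
    (hβ : 0 < β)
    (hT'sub : ∀ i j : Fin (k + 1), T' i.castSucc j.castSucc = T i j)
    (hT'β1 : T' (Fin.last (k + 1)) ((Fin.last k).castSucc) = β)
    (hT'β2 : T' ((Fin.last k).castSucc) (Fin.last (k + 1)) = β)
    (hT'α : T' (Fin.last (k + 1)) (Fin.last (k + 1)) = αk1)
    (hT'zero : ∀ i : Fin (k + 1), i ≠ Fin.last k →
      T' i.castSucc (Fin.last (k + 1)) = 0 ∧ T' (Fin.last (k + 1)) i.castSucc = 0)
    (hθ' : StrictMono θ')
    (hS' : S' * S'ᵀ = 1)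
    (hspec' : T' = S' * Matrix.diagonal θ' * S'ᵀ)
    (hlam1 : lam1 < θ' 0)
    (η : ℝ → Fin (k + 1) → ℝ)
    (hη : ∀ ν i, η ν i = (β * S (Fin.last k) i) ^ 2 / (θ i - ν))
    (E : ℝ → ℝ → ℝ)
    (hE : ∀ ν ξ : ℝ, E ν ξ = 1 + ∑ i ∈ Finset.Ioi (0 : Fin (k + 1)), η ν i / (θ i - ξ))
    (αlam1 : ℝ)
    (hαlam1 : αlam1 = lam1 + β ^ 2 *
      (Pi.single (Fin.last k) 1 ⬝ᵥ (T - lam1 • 1)⁻¹ *ᵥ Pi.single (Fin.last k) 1)) :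
    αk1 - αlam1
      = η lam1 0 * ((θ' 0 - lam1) / (θ 0 - θ' 0))
        + (θ' 0 - lam1) * E (θ' 0) lam1 := by
  have htri' : ∀ i j : Fin (k + 1), (i : ℕ) + 1 < (j : ℕ) ∨ (j : ℕ) + 1 < (i : ℕ) → T i j = 0 := by
    rintro i j (h | h)
    · exact htri i j h
    · rw [← hsymm.apply, htri j i h]
  have hoff' : ∀ i : Fin k, T i.succ i.castSucc ≠ 0 := fun i => by
    rw [hsymm.apply]
    exact (hoff i).ne'
  have htop : ∀ (x : Fin (k + 2) → ℝ) (i : Fin (k + 1)), (T' *ᵥ x) i.castSucc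
      = (T *ᵥ fun j => x j.castSucc) i
        + β * x (Fin.last _) * (Pi.single (Fin.last k) 1 : Fin (k + 1) → ℝ) i := by
    intro x i
    simp only [mulVec, dotProduct, Fin.sum_univ_castSucc (n := k + 1), hT'sub]
    congr 1
    by_cases hi : i = Fin.last k
    · subst hi
      simp [hT'β2]
    · simp [hi, (hT'zero i hi).1]
  have hbot : ∀ x : Fin (k + 2) → ℝ, (T' *ᵥ x) (Fin.last _)
      = β * x (Fin.last k).castSucc + αk1 * x (Fin.last _) := by
    intro x
    simp only [mulVec, dotProduct, Fin.sum_univ_castSucc (n := k + 1), hT'α]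
    congr 1
    rw [Finset.sum_eq_single (Fin.last k), hT'β1]
    · intro j _ hj
      rw [(hT'zero j hj).2, zero_mul]
    · simp
  have hlt : θ' 0 < θ 0 := by
    have hq := mulVec_col_of_spectral hS hspec 0
    have hqq : S.col 0 ⬝ᵥ S.col 0 = 1 := col_dotProduct_col_self hS 0
    have hlast : S.col 0 (Fin.last k) ≠ 0 := fun h => by
      simp [eq_zero_of_tridiagonal_mulVec_of_last htri' hoff' hq h] at hqq
    have hx : T' *ᵥ Fin.snoc (α := fun _ => ℝ) (S.col 0) 0
        ≠ θ' 0 • Fin.snoc (α := fun _ => ℝ) (S.col 0) 0 := by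
      intro h
      have := congrFun h (Fin.last _)
      rw [hbot] at this
      simp only [Fin.snoc_castSucc, Fin.snoc_last, Pi.smul_apply, smul_zero, mul_zero,
        add_zero] at this
      exact mul_ne_zero hβ.ne' hlast this
    have := dotProduct_mulVec_of_spectral_lt hS' hspec'
      (fun i => hθ'.monotone (Fin.zero_le i)) hx
    simp only [dotProduct, Fin.sum_univ_castSucc (n := k + 1), htop, Fin.snoc_castSucc,
      Fin.snoc_last, hq, mul_zero, zero_mul, add_zero, Pi.smul_apply, smul_eq_mul,
      mul_left_comm _ (θ 0), ← Finset.mul_sum] at this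
    simp only [dotProduct] at hqq
    simpa only [hqq, mul_one] using this
  have hθpos : ∀ i, 0 < θ i - θ' 0 := fun i => by
    linarith [hθ.monotone (Fin.zero_le i)]
  have hv := mulVec_col_of_spectral hS' hspec' 0
  have hv0 : S'.col 0 ≠ 0 := fun h => by
    have hvv : S'.col 0 ⬝ᵥ S'.col 0 = 1 := col_dotProduct_col_self hS' 0
    simp [h] at hvv
  set v := S'.col 0
  set w := v (Fin.last _)
  set u : Fin (k + 1) → ℝ := fun j => v j.castSucc
  have hTu : T *ᵥ u = θ' 0 • u - (β * w) • Pi.single (Fin.last k) 1 := by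
    ext i
    have := htop v i
    rw [hv] at this
    simp only [Pi.sub_apply, Pi.smul_apply, smul_eq_mul] at this ⊢
    linarith
  have hy : ∀ i, (Sᵀ *ᵥ u) i = -(β * w) * S (Fin.last k) i / (θ i - θ' 0) := fun i => by
    have h := transpose_mulVec_mulVec_of_spectral hS hspec u i
    rw [hTu, mulVec_sub, mulVec_smul, mulVec_smul, mulVec_single_one] at h
    simp only [Pi.sub_apply, Pi.smul_apply, smul_eq_mul, col_apply, transpose_apply] at h
    rw [eq_div_iff (hθpos i).ne']
    linarith
  have hw : w ≠ 0 := fun hw => hv0 <| by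
    have hu : u = 0 := eq_zero_of_transpose_mulVec_eq_zero hS <| by
      ext i
      rw [hy, hw]
      simp
    ext i
    refine Fin.lastCases hw (fun j => congrFun hu j) i
  have hulast : u (Fin.last k) = -(β * w) * ∑ i, S (Fin.last k) i ^ 2 / (θ i - θ' 0) := by
    have h : S *ᵥ (Sᵀ *ᵥ u) = u := by rw [mulVec_mulVec, hS, one_mulVec]
    rw [← h, mulVec, dotProduct, Finset.mul_sum]
    refine Finset.sum_congr rfl fun i _ => ?_
    rw [hy]
    ring
  have hα : αk1 = θ' 0 + β ^ 2 * ∑ i, S (Fin.last k) i ^ 2 / (θ i - θ' 0) := by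
    have h := hbot v
    rw [hv, Pi.smul_apply, smul_eq_mul] at h
    change θ' 0 * w = β * u (Fin.last k) + αk1 * w at h
    rw [hulast] at h
    refine mul_right_cancel₀ hw ?_
    linear_combination -h
  have hne : ∀ i, θ i - lam1 ≠ 0 := fun i => by linarith [hθpos i]
  have hdiff : αk1 - αlam1 = (θ' 0 - lam1)
      * (1 + ∑ i, η lam1 i / (θ i - θ' 0)) := by
    rw [hα, hαlam1, single_dotProduct_resolvent_of_spectral hS hspec hne]
    have h : ∑ i, η lam1 i / (θ i - θ' 0) * (θ' 0 - lam1)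
        = β ^ 2 * ∑ i, S (Fin.last k) i ^ 2 / (θ i - θ' 0)
          - β ^ 2 * ∑ i, S (Fin.last k) i ^ 2 / (θ i - lam1) := by
      rw [← mul_sub, ← Finset.sum_sub_distrib, Finset.mul_sum]
      refine Finset.sum_congr rfl fun i _ => ?_
      rw [hη]
      field_simp [hne i, (hθpos i).ne']
      ring
    rw [← Finset.sum_mul] at h
    linear_combination -h
  have hIoi : ∑ i ∈ Ioi (0 : Fin (k + 1)), η lam1 i / (θ i - θ' 0)
      = ∑ i ∈ Ioi (0 : Fin (k + 1)), η (θ' 0) i / (θ i - lam1) :=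
    Finset.sum_congr rfl fun i _ => by rw [hη, hη, div_right_comm]
  rw [hdiff, hE, ← hIoi, ← Finset.Ici_bot, ← Finset.add_sum_Ioi_eq_sum_Ici, bot_eq_zero]
  ring
end
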